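/- Let d_in, d_out, n ∈ ℕ with n ≥ 2, and let Δ_n = {[x_1,…,x_n] ∈ 𝔽^{d_in×n} : x_i ≠ x_j for all i ≠ j} be the set of matrices with pairwise distinct columns. Then for every π_{(1,2)}^n-equivariant function f* : Δ_n → 𝔽^{d_out×n} (i.e. f*(π_{(1,2)}^n X) = π_{(1,2)}^n f*(X) for all X ∈ Δ_n), there exists a floating-point transformer f : 𝔽^{d_in×n} → 𝔽^{d_out×n} such that f(X) = f*(X) for all X ∈ Δ_n. -/

import Mathlib

open scoped Classical

namespace FPT

noncomputable section

/-- Minimal exponent `𝔢_min = -2^(q-1) + 2`. -/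
def emin (q : ℕ) : ℤ := -(2 ^ (q - 1) : ℤ) + 2

/-- Maximal exponent `𝔢_max = 2^(q-1) - 1`. -/
def emax (q : ℕ) : ℤ := (2 ^ (q - 1) : ℤ) - 1

/-- The set of finite floating-point numbers with `p` mantissa bits and exponent bits `q`:
normal numbers `±(1.m₁⋯m_p)·2^e = m·2^(e-p)` with `2^p ≤ |m| ≤ 2^(p+1)-1` and
`emin ≤ e ≤ emax`, together with subnormal numbers `±(0.m₁⋯m_p)·2^emin = m·2^(emin-p)`
with `|m| ≤ 2^p - 1`. -/
def Fset (p q : ℕ) : Set ℝ :=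
  {x | ∃ m e : ℤ, |m| ≤ 2 ^ (p + 1) - 1 ∧ emin q ≤ e ∧ e ≤ emax q ∧
      ((2 : ℤ) ^ p ≤ |m| ∨ e = emin q) ∧ x = (m : ℝ) * (2 : ℝ) ^ (e - (p : ℤ))}

/-- The largest positive float `Ω = (2 - 2^(-p))·2^emax`. -/
def Omega (p q : ℕ) : ℝ := (2 - (2 : ℝ) ^ (-(p : ℤ))) * (2 : ℝ) ^ (emax q)

/-- Overflow threshold `Ω + 2^(emax - p - 1)`. -/
def thr (p q : ℕ) : ℝ := Omega p q + (2 : ℝ) ^ (emax q - (p : ℤ) - 1)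

/-- `y` is a float whose last mantissa bit `m_p` is zero, i.e. `y = m·2^(e-p)` with `m` even. -/
def EvenMantissa (p q : ℕ) (y : ℝ) : Prop :=
  ∃ m e : ℤ, |m| ≤ 2 ^ (p + 1) - 1 ∧ emin q ≤ e ∧ e ≤ emax q ∧
    ((2 : ℤ) ^ p ≤ |m| ∨ e = emin q) ∧ y = (m : ℝ) * (2 : ℝ) ^ (e - (p : ℤ)) ∧ 2 ∣ m

/-- `RoundsTo p q x y` : `y` is the rounding of `x` to the nearest float, ties to even. -/
def RoundsTo (p q : ℕ) (x y : ℝ) : Prop :=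
  y ∈ Fset p q ∧ (∀ z ∈ Fset p q, |x - y| ≤ |x - z|) ∧
    ((∀ z ∈ Fset p q, |x - z| = |x - y| → z = y) ∨ EvenMantissa p q y)

/-- Extended floats `𝔽̄ = 𝔽 ∪ {-∞, +∞, NaN}` (the payload of `fin` is meant to lie in `Fset`). -/
inductive EF where
  | fin : ℝ → EF
  | pinf : EF
  | ninf : EF
  | nan : EF

/-- Rounding `⌊·⌉ : ℝ → 𝔽̄`. -/
def rnd (p q : ℕ) (x : ℝ) : EF :=
  if thr p q ≤ x then .pinf
  else if x ≤ -thr p q then .ninf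
  else .fin (Classical.epsilon (RoundsTo p q x))

/-- Floating-point addition `⊕`. -/
def fadd (p q : ℕ) : EF → EF → EF
  | .nan, _ => .nan
  | _, .nan => .nan
  | .fin x, .fin y => rnd p q (x + y)
  | .fin _, .pinf => .pinf
  | .fin _, .ninf => .ninf
  | .pinf, .fin _ => .pinf
  | .ninf, .fin _ => .ninf
  | .pinf, .pinf => .pinf
  | .ninf, .ninf => .ninf
  | .pinf, .ninf => .nan
  | .ninf, .pinf => .nan

/-- Floating-point multiplication `⊗`. -/
def fmul (p q : ℕ) : EF → EF → EF
  | .nan, _ => .nan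
  | _, .nan => .nan
  | .fin x, .fin y => rnd p q (x * y)
  | .fin x, .pinf => if 0 < x then .pinf else if x < 0 then .ninf else .nan
  | .fin x, .ninf => if 0 < x then .ninf else if x < 0 then .pinf else .nan
  | .pinf, .fin y => if 0 < y then .pinf else if y < 0 then .ninf else .nan
  | .ninf, .fin y => if 0 < y then .ninf else if y < 0 then .pinf else .nan
  | .pinf, .pinf => .pinf
  | .ninf, .ninf => .pinf
  | .pinf, .ninf => .ninf
  | .ninf, .pinf => .ninf

/-- Floating-point subtraction `x ⊖ y = x ⊕ ((-1) ⊗ y)`. -/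
def fsub (p q : ℕ) (x y : EF) : EF := fadd p q x (fmul p q (.fin (-1)) y)

/-- Floating-point division (defined for `0 ≤ x ≤ y < ∞`, `y > 0`; NaN propagates). -/
def fdiv (p q : ℕ) : EF → EF → EF
  | _, .nan => .nan
  | .nan, _ => .nan
  | .fin x, .fin y => if 0 < y then rnd p q (x / y) else .nan
  | _, _ => .nan

/-- Correctly rounded exponential `⌊exp⌉`. -/
def fexp (p q : ℕ) : EF → EF
  | .fin x => rnd p q (Real.exp x)
  | .pinf => .pinf
  | .ninf => .fin 0
  | .nan => .nan

/-- Correctly rounded ReLU `ρ = ⌊ReLU⌉`. -/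
def frelu (p q : ℕ) : EF → EF
  | .fin x => rnd p q (max x 0)
  | .pinf => .pinf
  | .ninf => .fin 0
  | .nan => .nan

/-- Left-associative floating-point sum of a list (empty sum is `0`). -/
def fsuml (p q : ℕ) : List EF → EF
  | [] => .fin 0
  | x :: xs => xs.foldl (fadd p q) x

/-- Left-associative floating-point sum `⊕_{i=1}^{n} v i` over `Fin n`. -/
def fsum (p q : ℕ) {n : ℕ} (v : Fin n → EF) : EF := fsuml p q ((List.finRange n).map v)

/-- Matrices of extended floats. -/
abbrev Mat (a b : ℕ) := Fin a → Fin b → EF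

/-- Entrywise floating-point matrix addition. -/
def madd (p q : ℕ) {a b : ℕ} (M N : Mat a b) : Mat a b := fun i j => fadd p q (M i j) (N i j)

/-- Floating-point matrix multiplication with left-associative inner sums. -/
def mmul (p q : ℕ) {a b c : ℕ} (M : Mat a b) (N : Mat b c) : Mat a c :=
  fun i k => fsum p q (fun j => fmul p q (M i j) (N j k))

/-- Maximum of two extended floats (NaN-propagating). -/
def emax2 : EF → EF → EF
  | .nan, _ => .nan
  | _, .nan => .nan
  | .pinf, _ => .pinf
  | _, .pinf => .pinf
  | .fin x, .fin y => .fin (max x y)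
  | .fin x, .ninf => .fin x
  | .ninf, y => y

/-- Maximum entry of a vector of extended floats. -/
def vmax {n : ℕ} (v : Fin n → EF) : EF := ((List.finRange n).map v).foldl emax2 .ninf

/-- Floating-point softmax `σ(x)_i = ⌊exp⌉(x_i ⊖ x_*) ⊘ (⊕_j ⌊exp⌉(x_j ⊖ x_*))`. -/
def fsoftmax (p q : ℕ) {n : ℕ} (v : Fin n → EF) : Fin n → EF := fun i =>
  fdiv p q (fexp p q (fsub p q (v i) (vmax v)))
    (fsum p q (fun j => fexp p q (fsub p q (v j) (vmax v))))

/-- Column-wise application of the floating-point softmax. -/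
def colSoftmax (p q : ℕ) {k n : ℕ} (A : Mat k n) : Mat k n :=
  fun i j => fsoftmax p q (fun i' => A i' j) i

/-- The extended float is a finite float in `𝔽`. -/
def EF.IsF (p q : ℕ) : EF → Prop
  | .fin x => x ∈ Fset p q
  | _ => False

/-- The extended float is a well-formed element of `𝔽̄`. -/
def EF.Valid (p q : ℕ) : EF → Prop
  | .fin x => x ∈ Fset p q
  | _ => True

/-- The extended float is finite (not `±∞` or NaN). -/
def EF.Finite : EF → Prop
  | .fin _ => True
  | _ => False

/-- All entries of a vector are finite floats. -/
def VecFin (p q : ℕ) {a : ℕ} (v : Fin a → EF) : Prop := ∀ i, (v i).IsF p q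

/-- All entries of a matrix are finite floats. -/
def MatFin (p q : ℕ) {a b : ℕ} (M : Mat a b) : Prop := ∀ i j, (M i j).IsF p q

/-- Embed a real matrix as a matrix of extended floats. -/
def toEF {a b : ℕ} (M : Fin a → Fin b → ℝ) : Mat a b := fun i j => .fin (M i j)

/-- Parameters of one transformer block (attention layer followed by feed-forward layer)
with `h` heads, head dimension `m`, feed-forward width `r`, hidden dimension `d`. -/
structure Block (h m r d : ℕ) where
  WK : Fin h → Fin m → Fin d → ℝ
  WQ : Fin h → Fin m → Fin d → ℝ
  WV : Fin h → Fin m → Fin d → ℝ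
  WO : Fin h → Fin d → Fin m → ℝ
  W1 : Fin r → Fin d → ℝ
  W2 : Fin d → Fin r → ℝ
  b1 : Fin r → ℝ
  b2 : Fin d → ℝ

/-- All parameters of the block are floats. -/
def Block.Valid (p q : ℕ) {h m r d : ℕ} (B : Block h m r d) : Prop :=
  (∀ i a b, B.WK i a b ∈ Fset p q) ∧ (∀ i a b, B.WQ i a b ∈ Fset p q) ∧
    (∀ i a b, B.WV i a b ∈ Fset p q) ∧ (∀ i a b, B.WO i a b ∈ Fset p q) ∧
    (∀ a b, B.W1 a b ∈ Fset p q) ∧ (∀ a b, B.W2 a b ∈ Fset p q) ∧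
    (∀ a, B.b1 a ∈ Fset p q) ∧ (∀ a, B.b2 a ∈ Fset p q)

/-- The attention layer
`AT(X) = X ⊕ (⊕_i W_i^O ⊗ ((W_i^V ⊗ X) ⊗ σ((W_i^K ⊗ X)ᵀ ⊗ (W_i^Q ⊗ X))))`. -/
def attnApply (p q : ℕ) {h m r d : ℕ} (B : Block h m r d) {n : ℕ} (X : Mat d n) : Mat d n :=
  madd p q X (fun a b =>
    fsum p q (fun i =>
      (mmul p q (toEF (B.WO i))
        (mmul p q (mmul p q (toEF (B.WV i)) X)
          (colSoftmax p q
            (mmul p q (fun u v => mmul p q (toEF (B.WK i)) X v u)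
              (mmul p q (toEF (B.WQ i)) X))))) a b))

/-- The feed-forward layer `FF(X) = X ⊕ (W₂ ⊗ ρ(W₁ ⊗ X ⊕ b₁1ᵀ) ⊕ b₂1ᵀ)`. -/
def ffApply (p q : ℕ) {h m r d : ℕ} (B : Block h m r d) {n : ℕ} (X : Mat d n) : Mat d n :=
  madd p q X
    (madd p q
      (mmul p q (toEF B.W2)
        (fun i j => frelu p q
          ((madd p q (mmul p q (toEF B.W1) X) (fun a _ => .fin (B.b1 a))) i j)))
      (fun a _ => .fin (B.b2 a)))

/-- One transformer block: `FF ∘ AT`. -/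
def Block.apply (p q : ℕ) {h m r d n : ℕ} (B : Block h m r d) (X : Mat d n) : Mat d n :=
  ffApply p q B (attnApply p q B X)

/-- Composition of a list of transformer blocks (applied from left to right). -/
def blocksApply (p q : ℕ) {h m r d n : ℕ} (L : List (Block h m r d)) (X : Mat d n) : Mat d n :=
  L.foldl (fun Y B => Block.apply p q B Y) X

/-- `f` is a floating-point transformer:
`f(X) = W_out ⊗ g(W_in ⊗ X ⊕ b_in 1ᵀ) ⊕ b_out 1ᵀ` with `g` a nonempty composition of
transformer blocks and all parameters finite floats. -/
def IsTransformer (p q din dout n : ℕ) (f : Mat din n → Mat dout n) : Prop :=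
  ∃ (h m r d : ℕ) (L : List (Block h m r d)) (Win : Fin d → Fin din → ℝ) (bin : Fin d → ℝ)
      (Wout : Fin dout → Fin d → ℝ) (bout : Fin dout → ℝ),
    0 < h ∧ 0 < m ∧ 0 < r ∧ 0 < d ∧ L ≠ [] ∧ (∀ B ∈ L, B.Valid p q) ∧
      (∀ i j, Win i j ∈ Fset p q) ∧ (∀ i, bin i ∈ Fset p q) ∧
      (∀ i j, Wout i j ∈ Fset p q) ∧ (∀ i, bout i ∈ Fset p q) ∧
      ∀ X : Mat din n,
        f X = madd p q
          (mmul p q (toEF Wout)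
            (blocksApply p q L
              (madd p q (mmul p q (toEF Win) X) (fun i _ => .fin (bin i)))))
          (fun i _ => .fin (bout i))

/-- Column permutation: column `j` of `permCols π X` is column `π j` of `X`. -/
def permCols {a n : ℕ} (π : Equiv.Perm (Fin n)) (X : Mat a n) : Mat a n := fun i j => X i (π j)

/-- The transposition `π_{(1,2)}^n` of the first two coordinates. -/
def swap12 (n : ℕ) (hn : 2 ≤ n) : Equiv.Perm (Fin n) :=
  Equiv.swap ⟨0, by omega⟩ ⟨1, by omega⟩

/-- The columns of `X` are pairwise distinct. -/
def DistinctCols {a n : ℕ} (X : Mat a n) : Prop :=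
  ∀ j k : Fin n, j ≠ k → ∃ i, X i j ≠ X i k

/-- `(α,β)`-similarity (with 1-based column index `i = j+1`). -/
def Similar {a n : ℕ} (α β : ℕ) (X Y : Mat a n) : Prop :=
  ∃ z1 z2 : Fin a → EF,
    (∀ j : Fin n, (j : ℕ) + 1 ≤ α → ∀ i, X i j = z1 i) ∧
    (∀ j : Fin n, α < (j : ℕ) + 1 → (j : ℕ) + 1 ≤ β → ∀ i, X i j = z2 i) ∧
    (∀ j : Fin n, (j : ℕ) + 1 < α → ∀ i, Y i j = z1 i) ∧
    (∀ j : Fin n, α ≤ (j : ℕ) + 1 → (j : ℕ) + 1 ≤ β → ∀ i, Y i j = z2 i) ∧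
    (∀ j : Fin n, β < (j : ℕ) + 1 → ∀ i, X i j = Y i j)

/-- The smallest float strictly greater than `x` (junk value if none exists). -/
def succF (p q : ℕ) (x : ℝ) : ℝ := sInf {y | y ∈ Fset p q ∧ x < y}

/-- Successor on extended floats: the smallest element of `𝔽 ∪ {+∞}` strictly above. -/
def succEF (p q : ℕ) : EF → EF
  | .fin r => if ∃ y ∈ Fset p q, r < y then .fin (succF p q r) else .pinf
  | e => e

/-- Floating-point affine transformation `φ(x) = W ⊗ x ⊕ b`. -/
def affApply (p q : ℕ) {a b : ℕ} (W : Fin b → Fin a → ℝ) (c : ℝ) (v : Fin a → EF) :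
    Fin b → EF :=
  fun i => fadd p q (fsum p q (fun j => fmul p q (.fin (W i j)) (v j))) (.fin c)

/-- All intermediate values of `φ(x) = W ⊗ x ⊕ b` on input `v`, including every
left-associative partial sum of the matrix–vector product, are finite. -/
def AffIntermFin (p q : ℕ) {a b : ℕ} (W : Fin b → Fin a → ℝ) (c : ℝ) (v : Fin a → EF) : Prop :=
  ∀ i : Fin b,
    (∀ k : ℕ,
      (fsuml p q (((List.finRange a).take k).map
        (fun j => fmul p q (.fin (W i j)) (v j)))).Finite) ∧
    (affApply p q W c v i).Finite

end
end FPT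

namespace FPT

/-! ### The format -/

/-- The admissible range of the format parameters. -/
def Adm (p q : ℕ) : Prop := 2 ≤ p ∧ (p : ℤ) ≤ 2 ^ (q - 1) - 3

variable {p q : ℕ}

lemma emin_eq (q : ℕ) : emin q = 1 - emax q := by
  unfold emin emax; ring

lemma Adm.le_emax (h : Adm p q) : (p : ℤ) + 2 ≤ emax q := by
  have := h.2
  unfold emax
  linarith

lemma Adm.seven_le (h : Adm p q) : 7 ≤ emax q := by
  have h1 := h.1
  have h2 := h.2
  have h3 : 3 ≤ q - 1 := by
    by_contra hc
    have : (2 : ℤ) ^ (q - 1) ≤ 2 ^ 2 := pow_le_pow_right₀ (by norm_num) (by omega)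
    have : (2 : ℤ) ≤ p := by exact_mod_cast h1
    linarith
  have : (2 : ℤ) ^ 3 ≤ 2 ^ (q - 1) := pow_le_pow_right₀ (by norm_num) h3
  unfold emax
  linarith

lemma two_zpow_pos (e : ℤ) : (0 : ℝ) < 2 ^ e := by positivity

lemma two_zpow_le {a b : ℤ} (h : a ≤ b) : (2 : ℝ) ^ a ≤ 2 ^ b :=
  zpow_le_zpow_right₀ (by norm_num) h

lemma two_zpow_lt {a b : ℤ} (h : a < b) : (2 : ℝ) ^ a < 2 ^ b :=
  zpow_lt_zpow_right₀ (by norm_num) h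

lemma two_zpow_add (a b : ℤ) : (2 : ℝ) ^ (a + b) = 2 ^ a * 2 ^ b :=
  zpow_add₀ (by norm_num) a b

lemma neg_mem_Fset {x : ℝ} (h : x ∈ Fset p q) : -x ∈ Fset p q := by
  obtain ⟨m, e, h1, h2, h3, h4, rfl⟩ := h
  exact ⟨-m, e, by rwa [abs_neg], h2, h3, by rwa [abs_neg], by push_cast; ring⟩

lemma mem_Fset_of_abs_lt (m e : ℤ) (hm : |m| ≤ 2 ^ (p + 1) - 1) (h1 : emin q ≤ e)
    (h2 : e ≤ emax q) : (m : ℝ) * 2 ^ (e - (p : ℤ)) ∈ Fset p q := by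
  obtain ⟨k, hk⟩ : ∃ k : ℕ, e = emin q + k := ⟨(e - emin q).toNat, by omega⟩
  induction k generalizing m e with
  | zero => exact ⟨m, e, hm, h1, h2, Or.inr (by simpa using hk), rfl⟩
  | succ k ih =>
    by_cases hc : (2 : ℤ) ^ p ≤ |m|
    · exact ⟨m, e, hm, h1, h2, Or.inl hc, rfl⟩
    · have := ih (2 * m) (e - 1) (by rw [abs_mul, abs_two, pow_succ]; omega)
        (by push_cast at hk; omega) (by omega) (by push_cast at hk; omega)
      have he : (2 : ℝ) ^ (e - (p : ℤ)) = 2 * 2 ^ (e - 1 - (p : ℤ)) := by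
        rw [show e - (p : ℤ) = 1 + (e - 1 - (p : ℤ)) by ring, two_zpow_add, zpow_one]
      rw [he]
      convert this using 1
      push_cast; ring

lemma mem_Fset_of_abs_le (m e : ℤ) (hm : |m| ≤ 2 ^ (p + 1)) (h1 : emin q ≤ e)
    (h2 : e < emax q) : (m : ℝ) * 2 ^ (e - (p : ℤ)) ∈ Fset p q := by
  by_cases hc : |m| = 2 ^ (p + 1)
  · obtain ⟨k, hk⟩ : (2 : ℤ) ∣ m := by
      rw [← dvd_abs, hc]; exact dvd_pow_self _ (by omega)
    have h3 : |k| = 2 ^ p := by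
      rw [hk, abs_mul, abs_two, pow_succ] at hc; omega
    have : (1 : ℤ) ≤ 2 ^ p := one_le_pow₀ (by norm_num)
    have := mem_Fset_of_abs_lt (p := p) (q := q) k (e + 1) (by rw [h3, pow_succ]; omega)
      (by omega) (by omega)
    rw [hk]
    convert this using 1
    rw [show e + 1 - (p : ℤ) = 1 + (e - (p : ℤ)) by ring, two_zpow_add, zpow_one]
    push_cast; ring
  · exact mem_Fset_of_abs_lt m e (by omega) h1 h2.le

lemma Adm.zero_mem (h : Adm p q) : (0 : ℝ) ∈ Fset p q := by
  have := h.seven_le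
  have h1 : (0 : ℤ) ≤ 2 ^ (p + 1) - 1 := by
    have : (1 : ℤ) ≤ 2 ^ (p + 1) := one_le_pow₀ (by norm_num)
    omega
  simpa using mem_Fset_of_abs_lt (p := p) (q := q) 0 0 (by simpa using h1)
    (by rw [emin_eq]; omega) (by omega)

lemma Adm.two_zpow_mem (h : Adm p q) {k : ℤ} (h1 : emin q - p ≤ k) (h2 : k ≤ emax q) :
    (2 : ℝ) ^ k ∈ Fset p q := by
  have h7 := h.seven_le
  have h3 := h.le_emax
  have hp : (1 : ℤ) ≤ 2 ^ p := one_le_pow₀ (by norm_num)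
  by_cases hk : emin q ≤ k
  · have := mem_Fset_of_abs_lt (p := p) (q := q) (2 ^ p) k
      (by rw [abs_of_pos (by positivity), pow_succ]; omega) hk h2
    convert this using 1
    push_cast
    rw [← zpow_natCast, ← two_zpow_add]
    congr 1; ring
  · have := mem_Fset_of_abs_lt (p := p) (q := q) 1 (k + p)
      (by rw [abs_one, pow_succ]; omega) (by omega) (by rw [emin_eq] at hk; omega)
    convert this using 1
    simp

lemma Adm.one_mem (h : Adm p q) : (1 : ℝ) ∈ Fset p q := by
  have := h.seven_le
  simpa using h.two_zpow_mem (k := 0) (by rw [emin_eq]; omega) (by omega)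

/-- A float of modulus at least `2 ^ E` is an integer multiple of `2 ^ (E - p)`. -/
lemma exists_eq_mul_of_mem {x : ℝ} (hx : x ∈ Fset p q) {E : ℤ}
    (hE : E ≤ emin q ∨ (2 : ℝ) ^ E ≤ |x|) : ∃ k : ℤ, x = k * 2 ^ (E - (p : ℤ)) := by
  obtain ⟨m, e, h1, h2, h3, h4, rfl⟩ := hx
  have hEe : E ≤ e := by
    rcases hE with hE | hE
    · omega
    · by_contra hc
      rw [abs_mul, abs_of_pos (two_zpow_pos _)] at hE
      have h5 : (|(m : ℝ)|) < 2 ^ ((p : ℤ) + 1) := by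
        have : |m| < 2 ^ (p + 1) := by omega
        have h6 : ((|m| : ℤ) : ℝ) < ((2 ^ (p + 1) : ℤ) : ℝ) := by exact_mod_cast this
        rw [Int.cast_abs] at h6
        refine h6.trans_eq ?_
        push_cast
        rw [← zpow_natCast]; push_cast; rfl
      have h7 : |(m : ℝ)| * 2 ^ (e - (p : ℤ)) < 2 ^ ((p : ℤ) + 1) * 2 ^ (e - (p : ℤ)) :=
        mul_lt_mul_of_pos_right h5 (two_zpow_pos _)
      rw [← two_zpow_add] at h7
      have h8 : (2 : ℝ) ^ ((p : ℤ) + 1 + (e - p)) ≤ 2 ^ E := two_zpow_le (by omega)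
      linarith
  refine ⟨m * 2 ^ (e - E).toNat, ?_⟩
  push_cast
  rw [← zpow_natCast, Int.toNat_of_nonneg (by omega), mul_assoc, ← two_zpow_add]
  congr 2; ring

lemma eq_of_multiples_lt {a b δ : ℝ} (k l : ℤ) (ha : a = k * δ) (hb : b = l * δ)
    (hδ : 0 < δ) (h : |a - b| < δ) : a = b := by
  have h1 : |((k - l : ℤ) : ℝ)| * δ < 1 * δ := by
    rw [one_mul]
    refine lt_of_eq_of_lt ?_ h
    rw [ha, hb, ← sub_mul, abs_mul, abs_of_pos hδ]
    push_cast; rfl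
  have h2 : |((k - l : ℤ) : ℝ)| < 1 := lt_of_mul_lt_mul_right h1 hδ.le
  have h3 : |k - l| < 1 := by exact_mod_cast h2
  have h4 : k = l := by rw [Int.abs_lt_one_iff] at h3; omega
  rw [ha, hb, h4]

lemma Omega_eq : Omega p q = ((2 ^ (p + 1) - 1 : ℤ) : ℝ) * 2 ^ (emax q - (p : ℤ)) := by
  unfold Omega
  rw [sub_eq_add_neg (emax q) (p : ℤ), two_zpow_add]
  have : (2 : ℝ) ^ p * 2 ^ (-(p : ℤ)) = 1 := by
    rw [← zpow_natCast, ← two_zpow_add]; simp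
  push_cast
  rw [pow_succ]
  linear_combination (-2 * (2 : ℝ) ^ emax q) * this

lemma abs_le_Omega {x : ℝ} (hx : x ∈ Fset p q) : |x| ≤ Omega p q := by
  obtain ⟨m, e, h1, h2, h3, h4, rfl⟩ := hx
  rw [Omega_eq, abs_mul, abs_of_pos (two_zpow_pos _)]
  have : (1 : ℤ) ≤ 2 ^ (p + 1) := one_le_pow₀ (by norm_num)
  have h5 : |(m : ℝ)| ≤ ((2 ^ (p + 1) - 1 : ℤ) : ℝ) := by
    rw [← Int.cast_abs]; exact_mod_cast h1
  have h6 : (0 : ℝ) ≤ ((2 ^ (p + 1) - 1 : ℤ) : ℝ) := Int.cast_nonneg (by omega)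
  exact mul_le_mul h5 (two_zpow_le (by omega)) (two_zpow_pos _).le h6

lemma Omega_lt_thr : Omega p q < thr p q := by
  unfold thr
  have := two_zpow_pos (emax q - (p : ℤ) - 1)
  linarith

lemma abs_lt_thr {x : ℝ} (hx : x ∈ Fset p q) : |x| < thr p q :=
  (abs_le_Omega hx).trans_lt Omega_lt_thr

lemma Fset_finite (p q : ℕ) : (Fset p q).Finite := by
  have : Fset p q ⊆ Set.image (fun z : ℤ × ℤ => (z.1 : ℝ) * 2 ^ (z.2 - (p : ℤ)))
      (Set.Icc (-(2 ^ (p + 1))) (2 ^ (p + 1)) ×ˢ Set.Icc (emin q) (emax q)) := by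
    rintro x ⟨m, e, h1, h2, h3, -, rfl⟩
    refine ⟨(m, e), ⟨?_, h2, h3⟩, rfl⟩
    rw [Set.mem_Icc, ← abs_le]
    show |m| ≤ _
    omega
  exact ((Set.toFinite _).image _).subset this

/-! ### Rounding -/

lemma EvenMantissa.neg {y : ℝ} (h : EvenMantissa p q y) : EvenMantissa p q (-y) := by
  obtain ⟨m, e, h1, h2, h3, h4, rfl, h5⟩ := h
  exact ⟨-m, e, by rwa [abs_neg], h2, h3, by rwa [abs_neg], by push_cast; ring, h5.neg_right⟩

/-- Of two consecutive floats, the smaller one being nonnegative, one is even. -/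
lemma Adm.even_or_even_of_nonneg (h : Adm p q) {y z : ℝ} (hy : y ∈ Fset p q)
    (hz : z ∈ Fset p q) (hyz : y < z) (h0 : 0 ≤ y)
    (hcons : ∀ w ∈ Fset p q, y < w → z ≤ w) : EvenMantissa p q y ∨ EvenMantissa p q z := by
  have hzO := (le_abs_self z).trans (abs_le_Omega hz)
  obtain ⟨m, e, h1, h2, h3, h4, rfl⟩ := hy
  have hm0 : 0 ≤ m := by
    have := nonneg_of_mul_nonneg_left h0 (two_zpow_pos _)
    exact_mod_cast this
  rw [abs_of_nonneg hm0] at h1 h4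
  rcases Int.even_or_odd' m with ⟨k, hk | hk⟩
  · left
    refine ⟨m, e, by rwa [abs_of_nonneg hm0], h2, h3, by rwa [abs_of_nonneg hm0], rfl, ⟨k, hk⟩⟩
  · right
    have hE : e ≤ emin q ∨ (2 : ℝ) ^ e ≤ |z| := by
      rcases h4 with h4 | h4
      · right
        refine le_trans ?_ (le_abs_self z)
        refine le_trans ?_ hyz.le
        have : (2 : ℝ) ^ (p : ℤ) ≤ m := by rw [zpow_natCast]; exact_mod_cast h4
        calc (2 : ℝ) ^ e = 2 ^ (p : ℤ) * 2 ^ (e - (p : ℤ)) := by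
              rw [← two_zpow_add]; congr 1; ring
          _ ≤ _ := mul_le_mul_of_nonneg_right this (two_zpow_pos _).le
      · left; omega
    obtain ⟨l, hl⟩ := exists_eq_mul_of_mem hz hE
    have hml : m < l := by
      rw [hl] at hyz
      exact_mod_cast lt_of_mul_lt_mul_right hyz (two_zpow_pos _).le
    have hnot : ¬ (m = 2 ^ (p + 1) - 1 ∧ e = emax q) := by
      rintro ⟨rfl, rfl⟩
      rw [Omega_eq] at hzO
      exact absurd hyz (not_lt.mpr hzO)
    have hmem : ((m + 1 : ℤ) : ℝ) * 2 ^ (e - (p : ℤ)) ∈ Fset p q := by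
      by_cases hc : e = emax q
      · refine mem_Fset_of_abs_lt _ _ ?_ h2 h3
        rw [abs_of_nonneg (by omega)]
        have : m ≠ 2 ^ (p + 1) - 1 := fun h => hnot ⟨h, hc⟩
        omega
      · exact mem_Fset_of_abs_le _ _ (by rw [abs_of_nonneg (by omega)]; omega) h2 (by omega)
    have hle := hcons _ hmem (by
      apply mul_lt_mul_of_pos_right _ (two_zpow_pos _)
      push_cast; linarith)
    have hlm : l = m + 1 := by
      rw [hl] at hle
      have : l ≤ m + 1 := by exact_mod_cast le_of_mul_le_mul_right hle (two_zpow_pos _)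
      omega
    subst hlm
    by_cases hc : m = 2 ^ (p + 1) - 1
    · have hp1 := h.1
      refine ⟨2 ^ p, e + 1, ?_, by omega, ?_, Or.inl (le_abs_self _), ?_,
        dvd_pow_self _ (by omega)⟩
      · rw [abs_of_pos (by positivity), pow_succ]
        have : (1 : ℤ) ≤ 2 ^ p := one_le_pow₀ (by norm_num)
        omega
      · have : e ≠ emax q := fun h => hnot ⟨hc, h⟩
        omega
      · rw [hl, hc, show e + 1 - (p : ℤ) = 1 + (e - p) by ring, two_zpow_add]
        push_cast
        rw [zpow_one]; ring
    · refine ⟨m + 1, e, ?_, h2, h3, ?_, hl, ⟨k + 1, by omega⟩⟩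
      · rw [abs_of_nonneg (by omega)]; omega
      · rw [abs_of_nonneg (by omega)]
        rcases h4 with h4 | h4
        · left; omega
        · right; exact h4

lemma Adm.even_or_even (h : Adm p q) {y z : ℝ} (hy : y ∈ Fset p q)
    (hz : z ∈ Fset p q) (hyz : y < z)
    (hcons : ∀ w ∈ Fset p q, w ≤ y ∨ z ≤ w) : EvenMantissa p q y ∨ EvenMantissa p q z := by
  rcases le_or_gt 0 y with h0 | h0
  · exact h.even_or_even_of_nonneg hy hz hyz h0
      fun w hw hyw => (hcons w hw).resolve_left (not_le.mpr hyw)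
  · have hz0 : z ≤ 0 := (hcons 0 h.zero_mem).resolve_left (not_le.mpr h0)
    have := h.even_or_even_of_nonneg (neg_mem_Fset hz) (neg_mem_Fset hy) (neg_lt_neg hyz)
      (by linarith) fun w hw hyw => by
        rcases hcons _ (neg_mem_Fset hw) with h1 | h1 <;> linarith
    rcases this with h1 | h1
    · right; simpa using h1.neg
    · left; simpa using h1.neg

lemma Adm.exists_roundsTo (h : Adm p q) (x : ℝ) : ∃ y, RoundsTo p q x y := by
  obtain ⟨y, hy, hmin⟩ := (Fset_finite p q).exists_minimalFor (fun y => |x - y|) _ ⟨0, h.zero_mem⟩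
  have hmin' : ∀ z ∈ Fset p q, |x - y| ≤ |x - z| := fun z hz => by
    by_contra hc
    exact hc (hmin hz (not_le.mp hc).le)
  by_cases hu : ∀ z ∈ Fset p q, |x - z| = |x - y| → z = y
  · exact ⟨y, hy, hmin', Or.inl hu⟩
  · push Not at hu
    obtain ⟨z, hz, hzy, hne⟩ := hu
    have key : ∀ a b : ℝ, a < b → |x - a| = |x - b| → (∀ w ∈ Fset p q, |x - a| ≤ |x - w|) →
        ∀ w ∈ Fset p q, w ≤ a ∨ b ≤ w := by
      intro a b hab h1 h2 w hw
      by_contra hc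
      push Not at hc
      have h3 : a + b = 2 * x := by
        rcases abs_eq_abs.mp h1 with h1 | h1 <;> linarith
      have h4 := h2 w hw
      rw [abs_of_nonneg (by linarith : 0 ≤ x - a)] at h4
      rcases abs_cases (x - w) with ⟨h5, _⟩ | ⟨h5, _⟩ <;> linarith
    have hev : EvenMantissa p q y ∨ EvenMantissa p q z := by
      rcases lt_or_gt_of_ne hne with hlt | hlt
      · exact (h.even_or_even hz hy hlt
          (key z y hlt hzy fun w hw => hzy ▸ hmin' w hw)).symm
      · exact h.even_or_even hy hz hlt (key y z hlt hzy.symm hmin')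
    rcases hev with he | he
    · exact ⟨y, hy, hmin', Or.inr he⟩
    · exact ⟨z, hz, fun w hw => hzy ▸ hmin' w hw, Or.inr he⟩

/-- The float nearest to `x`. -/
noncomputable def rd (p q : ℕ) (x : ℝ) : ℝ := Classical.epsilon (RoundsTo p q x)

lemma Adm.roundsTo_rd (h : Adm p q) (x : ℝ) : RoundsTo p q x (rd p q x) :=
  Classical.epsilon_spec (h.exists_roundsTo x)

lemma Adm.rd_mem (h : Adm p q) (x : ℝ) : rd p q x ∈ Fset p q := (h.roundsTo_rd x).1

lemma Adm.abs_sub_rd_le (h : Adm p q) (x : ℝ) {z : ℝ} (hz : z ∈ Fset p q) :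
    |x - rd p q x| ≤ |x - z| := (h.roundsTo_rd x).2.1 z hz

lemma Adm.rd_self (h : Adm p q) {x : ℝ} (hx : x ∈ Fset p q) : rd p q x = x := by
  have := h.abs_sub_rd_le x hx
  rw [sub_self, abs_zero] at this
  have := abs_nonpos_iff.mp this
  linarith

lemma Adm.rd_le (h : Adm p q) {x z : ℝ} (hz : z ∈ Fset p q) (hx : x ≤ z) : rd p q x ≤ z := by
  by_contra hc
  push Not at hc
  have := h.abs_sub_rd_le x hz
  rw [abs_of_nonpos (by linarith), abs_of_nonpos (by linarith)] at this
  linarith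

lemma Adm.le_rd (h : Adm p q) {x z : ℝ} (hz : z ∈ Fset p q) (hx : z ≤ x) : z ≤ rd p q x := by
  by_contra hc
  push Not at hc
  have := h.abs_sub_rd_le x hz
  rw [abs_of_nonneg (by linarith), abs_of_nonneg (by linarith)] at this
  linarith

lemma rnd_of_abs_lt {x : ℝ} (hx : |x| < thr p q) : rnd p q x = .fin (rd p q x) := by
  rw [abs_lt] at hx
  unfold rnd rd
  rw [if_neg (not_le.mpr hx.2), if_neg (not_le.mpr hx.1)]

lemma Adm.rnd_of_mem (h : Adm p q) {x : ℝ} (hx : x ∈ Fset p q) : rnd p q x = .fin x := by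
  rw [rnd_of_abs_lt (abs_lt_thr hx), h.rd_self hx]

/-- A perturbation below a quarter of the spacing is absorbed by rounding. -/
lemma Adm.rd_add_of_abs_lt (h : Adm p q) {x y : ℝ} {E : ℤ} (hx : x ∈ Fset p q)
    (hxE : (2 : ℝ) ^ E ≤ |x|) (hy : |y| < 2 ^ (E - (p : ℤ) - 2)) : rd p q (x + y) = x := by
  set z := rd p q (x + y) with hz
  have h1 : |x + y - z| ≤ |y| := by simpa using h.abs_sub_rd_le (x + y) hx
  have e1 : (2 : ℝ) ^ (E - 1 - (p : ℤ)) = 2 * 2 ^ (E - (p : ℤ) - 2) := by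
    rw [show E - 1 - (p : ℤ) = 1 + (E - p - 2) by ring, two_zpow_add, zpow_one]
  have h2 : |z - x| < 2 ^ (E - 1 - (p : ℤ)) := by
    rw [e1]
    have : z - x = y - (x + y - z) := by ring
    rw [this]
    linarith [abs_sub y (x + y - z)]
  have e2 : (2 : ℝ) ^ E = 2 * 2 ^ (E - 1) := by
    rw [show E = 1 + (E - 1) by ring, two_zpow_add, zpow_one]; simp
  have h3 : (2 : ℝ) ^ (E - 1 - (p : ℤ)) ≤ 2 ^ (E - 1) := two_zpow_le (by omega)
  have h4 : (2 : ℝ) ^ (E - 1) ≤ |z| := by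
    have : |x| ≤ |z| + |z - x| := by
      have := abs_sub_abs_le_abs_sub x z
      rw [abs_sub_comm] at this
      linarith
    linarith
  obtain ⟨k, hk⟩ := exists_eq_mul_of_mem (h.rd_mem (x + y)) (Or.inr h4)
  obtain ⟨l, hl⟩ := exists_eq_mul_of_mem hx (E := E - 1)
    (Or.inr (by have := two_zpow_pos (E - 1); linarith))
  exact eq_of_multiples_lt k l hk hl (two_zpow_pos _) h2

/-- Every positive multiple of the least positive float is at least that float. -/
lemma omega_le_sub {a b : ℝ} (ha : a ∈ Fset p q) (hb : b ∈ Fset p q) (hab : b < a) :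
    (2 : ℝ) ^ (emin q - (p : ℤ)) ≤ a - b := by
  obtain ⟨k, hk⟩ := exists_eq_mul_of_mem ha (E := emin q) (Or.inl le_rfl)
  obtain ⟨l, hl⟩ := exists_eq_mul_of_mem hb (E := emin q) (Or.inl le_rfl)
  by_contra hc
  push Not at hc
  exact hab.ne' (eq_of_multiples_lt k l hk hl (two_zpow_pos _)
    (by rwa [abs_of_pos (by linarith)]))

/-! ### Arithmetic and sums of extended floats -/

lemma Adm.rnd_valid (h : Adm p q) (x : ℝ) : (rnd p q x).Valid p q := by
  unfold rnd
  split_ifs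
  · trivial
  · trivial
  · exact h.rd_mem x

lemma Adm.fadd_valid (h : Adm p q) (x y : EF) : (fadd p q x y).Valid p q := by
  cases x <;> cases y <;> first | exact h.rnd_valid _ | trivial

lemma Adm.zero_valid (h : Adm p q) : (EF.fin 0).Valid p q := h.zero_mem

lemma valid_fin {x : ℝ} (hx : x ∈ Fset p q) : (EF.fin x).Valid p q := hx

lemma Adm.fadd_zero (h : Adm p q) {x : EF} (hx : x.Valid p q) : fadd p q x (.fin 0) = x := by
  cases x with
  | fin r => simpa [fadd] using h.rnd_of_mem hx
  | _ => rfl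

lemma Adm.zero_fadd (h : Adm p q) {x : EF} (hx : x.Valid p q) : fadd p q (.fin 0) x = x := by
  cases x with
  | fin r => simpa [fadd] using h.rnd_of_mem hx
  | _ => rfl

lemma Adm.zero_fmul (h : Adm p q) (x : ℝ) : fmul p q (.fin 0) (.fin x) = .fin 0 := by
  simpa [fmul] using h.rnd_of_mem h.zero_mem

lemma Adm.fmul_zero (h : Adm p q) (x : ℝ) : fmul p q (.fin x) (.fin 0) = .fin 0 := by
  simpa [fmul] using h.rnd_of_mem h.zero_mem

lemma Adm.one_fmul (h : Adm p q) {x : ℝ} (hx : x ∈ Fset p q) :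
    fmul p q (.fin 1) (.fin x) = .fin x := by
  simpa [fmul] using h.rnd_of_mem hx

lemma Adm.fmul_one (h : Adm p q) {x : ℝ} (hx : x ∈ Fset p q) :
    fmul p q (.fin x) (.fin 1) = .fin x := by
  simpa [fmul] using h.rnd_of_mem hx

lemma Adm.foldl_fadd_zeros (h : Adm p q) {l : List EF} {a : EF} (ha : a.Valid p q)
    (hl : ∀ x ∈ l, x = .fin 0) : l.foldl (fadd p q) a = a := by
  induction l with
  | nil => rfl
  | cons x l ih =>
    rw [List.foldl_cons, hl x List.mem_cons_self, h.fadd_zero ha]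
    exact ih fun y hy => hl y (List.mem_cons_of_mem _ hy)

lemma Adm.fsuml_eq_foldl (h : Adm p q) {l : List EF} (hl : ∀ x ∈ l, x.Valid p q) :
    fsuml p q l = l.foldl (fadd p q) (.fin 0) := by
  cases l with
  | nil => rfl
  | cons x l => rw [List.foldl_cons, h.zero_fadd (hl x List.mem_cons_self)]; rfl

lemma Adm.fsum_single (h : Adm p q) {n : ℕ} {v : Fin n → EF} (i₀ : Fin n)
    (hv : ∀ i, i ≠ i₀ → v i = .fin 0) (h0 : (v i₀).Valid p q) : fsum p q v = v i₀ := by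
  have hval : ∀ i, (v i).Valid p q := fun i => by
    by_cases hi : i = i₀
    · rwa [hi]
    · rw [hv i hi]; exact h.zero_mem
  unfold fsum
  rw [h.fsuml_eq_foldl (by simpa using hval)]
  obtain ⟨s, t, hst⟩ := List.mem_iff_append.mp (List.mem_finRange i₀)
  have hnd := hst ▸ List.nodup_finRange n
  rw [List.nodup_append] at hnd
  obtain ⟨-, h1, h2⟩ := hnd
  rw [List.nodup_cons] at h1
  rw [hst, List.map_append, List.foldl_append, List.map_cons, List.foldl_cons,
    h.foldl_fadd_zeros (l := s.map v) h.zero_valid, h.zero_fadd h0, h.foldl_fadd_zeros h0]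
  · intro x hx
    obtain ⟨i, hi, rfl⟩ := List.mem_map.mp hx
    exact hv i fun hc => h1.1 (hc ▸ hi)
  · intro x hx
    obtain ⟨i, hi, rfl⟩ := List.mem_map.mp hx
    exact hv i fun hc => h2 i hi i₀ List.mem_cons_self hc

lemma Adm.fsum_zero (h : Adm p q) {n : ℕ} {v : Fin n → EF} (hv : ∀ i, v i = .fin 0) :
    fsum p q v = .fin 0 := by
  unfold fsum
  have hz : ∀ x ∈ (List.finRange n).map v, x = EF.fin 0 := by simpa using hv
  rw [h.fsuml_eq_foldl fun x hx => by rw [hz x hx]; exact h.zero_mem]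
  exact h.foldl_fadd_zeros h.zero_mem hz

lemma Adm.frelu_fin (h : Adm p q) {x : ℝ} (hx : x ∈ Fset p q) :
    frelu p q (.fin x) = .fin (max x 0) := by
  refine h.rnd_of_mem ?_
  rcases max_choice x 0 with hm | hm <;> rw [hm]
  exacts [hx, h.zero_mem]

/-! ### Uniform attention weights -/

lemma Adm.rd_add_one_le (h : Adm p q) {a : ℝ} (ha : a ≤ 2 ^ ((p : ℤ) + 2)) :
    rd p q (a + 1) ≤ 2 ^ ((p : ℤ) + 2) := by
  by_contra hc
  push Not at hc
  have h2 := h.le_emax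
  have h7 := h.seven_le
  have hmem : (2 : ℝ) ^ ((p : ℤ) + 2) ∈ Fset p q :=
    h.two_zpow_mem (by rw [emin_eq]; omega) h2
  have hE : (2 : ℝ) ^ ((p : ℤ) + 2) ≤ |rd p q (a + 1)| := hc.le.trans (le_abs_self _)
  obtain ⟨k, hk⟩ := exists_eq_mul_of_mem (h.rd_mem (a + 1)) (Or.inr hE)
  obtain ⟨l, hl⟩ := exists_eq_mul_of_mem hmem (E := (p : ℤ) + 2) (Or.inr (le_abs_self _))
  have h4 : (2 : ℝ) ^ ((p : ℤ) + 2 - p) = 4 := by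
    rw [show (p : ℤ) + 2 - p = 2 by ring]; norm_num
  have hgap : 4 ≤ rd p q (a + 1) - 2 ^ ((p : ℤ) + 2) := by
    by_contra hlt
    push Not at hlt
    refine hc.ne' (eq_of_multiples_lt k l hk hl (two_zpow_pos _) ?_)
    rw [h4, abs_of_pos (by linarith)]
    exact hlt
  have hnear := h.abs_sub_rd_le (a + 1) hmem
  rw [abs_of_nonpos (by linarith)] at hnear
  rcases abs_cases (a + 1 - 2 ^ ((p : ℤ) + 2)) with ⟨h5, h6⟩ | ⟨h5, h6⟩ <;> linarith

lemma Adm.foldl_ones (h : Adm p q) (k : ℕ) {a : ℝ} (ha : a ∈ Fset p q)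
    (ha1 : 1 ≤ a) (ha2 : a ≤ 2 ^ ((p : ℤ) + 2)) :
    ∃ S ∈ Fset p q, 1 ≤ S ∧ S ≤ 2 ^ ((p : ℤ) + 2) ∧
      (List.replicate k (EF.fin 1)).foldl (fadd p q) (.fin a) = .fin S := by
  induction k generalizing a with
  | zero => exact ⟨a, ha, ha1, ha2, rfl⟩
  | succ k ih =>
    have h2 := h.le_emax
    have hlt : |a + 1| < thr p q := by
      have hO : (2 : ℝ) ^ (emax q) ≤ Omega p q :=
        (le_abs_self _).trans (abs_le_Omega (h.two_zpow_mem
          (by rw [emin_eq]; have := h.seven_le; omega) le_rfl))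
      have h3 : (2 : ℝ) ^ ((p : ℤ) + 2) ≤ 2 ^ emax q := two_zpow_le h2
      have h4 : (1 : ℝ) ≤ 2 ^ (emax q - (p : ℤ) - 1) := by
        have := two_zpow_le (show (0 : ℤ) ≤ emax q - (p : ℤ) - 1 by omega)
        simpa using this
      have h4' : (1 : ℝ) < 2 ^ (emax q - (p : ℤ) - 1) := by
        have := two_zpow_lt (show (0 : ℤ) < emax q - (p : ℤ) - 1 by omega)
        simpa using this
      rw [abs_of_pos (by linarith)]
      unfold thr
      linarith
    rw [List.replicate_succ, List.foldl_cons]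
    have : fadd p q (.fin a) (.fin 1) = .fin (rd p q (a + 1)) := rnd_of_abs_lt hlt
    rw [this]
    exact ih (h.rd_mem _) (ha1.trans (h.le_rd ha (by linarith))) (h.rd_add_one_le ha2)

lemma vmax_zero {n : ℕ} (hn : 0 < n) : vmax (fun _ : Fin n => EF.fin 0) = .fin 0 := by
  obtain ⟨k, rfl⟩ : ∃ k, n = k + 1 := ⟨n - 1, by omega⟩
  have : ∀ k, (List.replicate k (EF.fin 0)).foldl emax2 (.fin 0) = .fin 0 := by
    intro k
    induction k with
    | zero => rfl
    | succ k ih =>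
      rw [List.replicate_succ, List.foldl_cons]
      simpa [emax2] using ih
  unfold vmax
  rw [List.map_const', List.length_finRange, List.replicate_succ, List.foldl_cons]
  exact this k

lemma Adm.exists_softmax_zero (h : Adm p q) {n : ℕ} (hn : 0 < n) :
    ∃ s ∈ Fset p q, (2 : ℝ) ^ (-(p : ℤ) - 2) ≤ s ∧ s ≤ 1 ∧
      ∀ i, fsoftmax p q (fun _ : Fin n => EF.fin 0) i = .fin s := by
  have h2 := h.le_emax
  have h7 := h.seven_le
  have hneg : fmul p q (.fin (-1)) (.fin 0) = .fin 0 := h.fmul_zero _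
  have hsub : fsub p q (.fin 0) (.fin 0) = .fin 0 := by
    unfold fsub
    rw [hneg]
    exact h.fadd_zero h.zero_valid
  have hexp : fexp p q (.fin 0) = .fin 1 := by
    show rnd p q (Real.exp 0) = _
    rw [Real.exp_zero, h.rnd_of_mem h.one_mem]
  have hone : (1 : ℝ) ≤ 2 ^ ((p : ℤ) + 2) := by
    simpa using two_zpow_le (show (0 : ℤ) ≤ (p : ℤ) + 2 by omega)
  obtain ⟨k, rfl⟩ : ∃ k, n = k + 1 := ⟨n - 1, by omega⟩
  obtain ⟨S, -, hS1, hS2, hS⟩ := h.foldl_ones k h.one_mem le_rfl hone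
  have hsum : fsum p q (fun _ : Fin (k + 1) => EF.fin 1) = .fin S := by
    unfold fsum
    rw [List.map_const', List.length_finRange, List.replicate_succ]
    exact hS
  have hinv : 1 / S ≤ 1 := by rw [div_le_one (by linarith)]; exact hS1
  have hinv' : (2 : ℝ) ^ (-(p : ℤ) - 2) ≤ 1 / S := by
    rw [show -(p : ℤ) - 2 = -((p : ℤ) + 2) by ring, zpow_neg, ← one_div]
    exact one_div_le_one_div_of_le (by linarith) hS2
  refine ⟨rd p q (1 / S), h.rd_mem _, h.le_rd (h.two_zpow_mem ?_ ?_) hinv',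
    h.rd_le h.one_mem hinv, fun i => ?_⟩
  · rw [emin_eq]; omega
  · omega
  · unfold fsoftmax
    simp only [vmax_zero hn, hsub, hexp, hsum, fdiv]
    rw [if_pos (by linarith), rnd_of_abs_lt]
    rw [abs_of_pos (by positivity)]
    exact hinv.trans_lt ((le_abs_self _).trans_lt (abs_lt_thr h.one_mem))

/-- The attention weight given to each of `n` tokens by equal scores. -/
noncomputable def unifWeight (p q n : ℕ) : ℝ :=
  if hs : ∃ s : ℝ, s ∈ Fset p q ∧ (2 : ℝ) ^ (-(p : ℤ) - 2) ≤ s ∧ s ≤ 1 ∧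
      ∀ i, fsoftmax p q (fun _ : Fin n => EF.fin 0) i = .fin s
  then hs.choose else 0

lemma Adm.unifWeight_spec (h : Adm p q) {n : ℕ} (hn : 0 < n) :
    unifWeight p q n ∈ Fset p q ∧ (2 : ℝ) ^ (-(p : ℤ) - 2) ≤ unifWeight p q n ∧
      unifWeight p q n ≤ 1 ∧
      ∀ i, fsoftmax p q (fun _ : Fin n => EF.fin 0) i = .fin (unifWeight p q n) := by
  have hs := h.exists_softmax_zero hn
  unfold unifWeight
  rw [dif_pos hs]
  exact hs.choose_spec

/-! ### Layers -/

/-- All entries of a real matrix are floats. -/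
def RealMatFin (p q : ℕ) {a b : ℕ} (X : Fin a → Fin b → ℝ) : Prop := ∀ i j, X i j ∈ Fset p q

lemma Adm.mmul_zero_left (h : Adm p q) {a b c : ℕ} (X : Fin b → Fin c → ℝ) :
    mmul p q (toEF fun (_ : Fin a) (_ : Fin b) => (0 : ℝ)) (toEF X) = toEF fun _ _ => 0 := by
  funext i j
  exact h.fsum_zero fun k => h.zero_fmul _

/-- Attention with zero keys and queries averages the values. -/
lemma Adm.attnApply_eq (h : Adm p q) {m r d n : ℕ} (hn : 0 < n) (B : Block 1 m r d)
    (hK : B.WK = fun _ _ _ => 0) (hQ : B.WQ = fun _ _ _ => 0) (X : Fin d → Fin n → ℝ) :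
    attnApply p q B (toEF X) = madd p q (toEF X) (mmul p q (toEF (B.WO 0))
      (mmul p q (mmul p q (toEF (B.WV 0)) (toEF X)) (toEF fun _ _ => unifWeight p q n))) := by
  have hs : colSoftmax p q (toEF fun (_ : Fin n) (_ : Fin n) => (0 : ℝ))
      = toEF fun _ _ => unifWeight p q n := by
    funext i j
    exact (h.unifWeight_spec hn).2.2.2 i
  have hKQ : mmul p q (fun u v => mmul p q (toEF (B.WK 0)) (toEF X) v u)
      (mmul p q (toEF (B.WQ 0)) (toEF X)) = toEF fun _ _ => 0 := by
    rw [hK, hQ]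
    simp only [h.mmul_zero_left]
    exact h.mmul_zero_left _
  unfold attnApply
  simp only [fsum, List.finRange_succ, List.finRange_zero, List.map_nil, List.map_cons, fsuml,
    List.foldl_nil]
  rw [hKQ, hs]

lemma Adm.attnApply_zero (h : Adm p q) {m r d n : ℕ} (hn : 0 < n) (B : Block 1 m r d)
    (hK : B.WK = fun _ _ _ => 0) (hQ : B.WQ = fun _ _ _ => 0) (hV : B.WV = fun _ _ _ => 0)
    (hO : B.WO = fun _ _ _ => 0) {X : Fin d → Fin n → ℝ} (hX : RealMatFin p q X) :
    attnApply p q B (toEF X) = toEF X := by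
  rw [h.attnApply_eq hn B hK hQ X, hV, hO]
  simp only [h.mmul_zero_left]
  funext i j
  exact h.fadd_zero (hX i j)

/-- A block without attention whose feed-forward layer has the hidden units `H` and writes to
the registers `T`. -/
noncomputable def ffBlock (m : ℕ) {r d : ℕ} {H T : Type} (eH : H → Fin r) (eT : T → Fin d)
    (w₁ : H → Fin d → ℝ) (c₁ : H → ℝ) (w₂ : T → H → ℝ) (c₂ : T → ℝ) : Block 1 m r d where
  WK := fun _ _ _ => 0
  WQ := fun _ _ _ => 0
  WV := fun _ _ _ => 0
  WO := fun _ _ _ => 0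
  W1 := Function.extend eH w₁ 0
  W2 := Function.extend eT (fun t => Function.extend eH (w₂ t) 0) 0
  b1 := Function.extend eH c₁ 0
  b2 := Function.extend eT c₂ 0

lemma extend_cases {α β γ : Type} {f : α → β} (hf : Function.Injective f) (g : α → γ) (e : β → γ)
    {P : γ → Prop} (hg : ∀ a, P (g a)) (he : ∀ b, P (e b)) (b : β) :
    P (Function.extend f g e b) := by
  by_cases hb : ∃ a, f a = b
  · obtain ⟨a, rfl⟩ := hb
    rw [hf.extend_apply]; exact hg a
  · rw [Function.extend_apply' _ _ _ hb]; exact he b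

lemma Adm.ffBlock_valid (h : Adm p q) {m r d : ℕ} {H T : Type} {eH : H → Fin r} {eT : T → Fin d}
    (hH : Function.Injective eH) (hT : Function.Injective eT)
    {w₁ : H → Fin d → ℝ} {c₁ : H → ℝ} {w₂ : T → H → ℝ} {c₂ : T → ℝ}
    (h1 : ∀ u i, w₁ u i ∈ Fset p q) (h2 : ∀ u, c₁ u ∈ Fset p q) (h3 : ∀ t u, w₂ t u ∈ Fset p q)
    (h4 : ∀ t, c₂ t ∈ Fset p q) : (ffBlock m eH eT w₁ c₁ w₂ c₂).Valid p q := by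
  have h0 := h.zero_mem
  refine ⟨fun _ _ _ => h0, fun _ _ _ => h0, fun _ _ _ => h0, fun _ _ _ => h0, fun a => ?_,
    fun a => ?_, fun a => ?_, fun a => ?_⟩
  · exact extend_cases hH _ _ (P := fun f : Fin d → ℝ => ∀ b, f b ∈ Fset p q) h1 (fun _ _ => h0) a
  · refine extend_cases hT (fun t => Function.extend eH (w₂ t) 0) (0 : Fin d → Fin r → ℝ)
      (P := fun f : Fin r → ℝ => ∀ b, f b ∈ Fset p q) (fun t => ?_)
      (fun _ _ => h0) a
    exact extend_cases hH _ _ (P := fun x => x ∈ Fset p q) (h3 t) (fun _ => h0)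
  · exact extend_cases hH _ _ (P := fun x => x ∈ Fset p q) h2 (fun _ => h0) a
  · exact extend_cases hT _ _ (P := fun x => x ∈ Fset p q) h4 (fun _ => h0) a

/-- Overwrite the registers `eT t` of a state matrix. -/
noncomputable def upd {T : Type} {d n : ℕ} (eT : T → Fin d) (o : T → Fin n → ℝ)
    (X : Fin d → Fin n → ℝ) : Fin d → Fin n → ℝ :=
  Function.extend eT o X

lemma upd_fin {T : Type} {d n : ℕ} {eT : T → Fin d} (hT : Function.Injective eT)
    {o : T → Fin n → ℝ} {X : Fin d → Fin n → ℝ} (ho : ∀ t j, o t j ∈ Fset p q)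
    (hX : RealMatFin p q X) : RealMatFin p q (upd eT o X) := fun i =>
  extend_cases hT _ _ (P := fun f : Fin n → ℝ => ∀ b, f b ∈ Fset p q) ho hX i

lemma upd_apply {T : Type} {d n : ℕ} {eT : T → Fin d} (hT : Function.Injective eT)
    (o : T → Fin n → ℝ) (X : Fin d → Fin n → ℝ) (t : T) : upd eT o X (eT t) = o t :=
  hT.extend_apply _ _ _

lemma upd_apply' {T : Type} {d n : ℕ} {eT : T → Fin d}
    (o : T → Fin n → ℝ) (X : Fin d → Fin n → ℝ) {i : Fin d} (hi : ∀ t, eT t ≠ i) :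
    upd eT o X i = X i :=
  Function.extend_apply' _ _ _ (by push Not; exact hi)

/-- The effect of an `ffBlock` each of whose outputs depends on at most one active hidden
unit. -/
lemma Adm.ffBlock_apply (h : Adm p q) {m r d n : ℕ} (hn : 0 < n) {H T : Type} {eH : H → Fin r}
    {eT : T → Fin d} (hH : Function.Injective eH) (hT : Function.Injective eT)
    {w₁ : H → Fin d → ℝ} {c₁ : H → ℝ} {w₂ : T → H → ℝ} {c₂ : T → ℝ}
    {X : Fin d → Fin n → ℝ} (hX : RealMatFin p q X) {g : H → Fin n → ℝ} {o : T → Fin n → ℝ}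
    (hg : ∀ u j, frelu p q (fadd p q (fsum p q fun i => fmul p q (.fin (w₁ u i)) (.fin (X i j)))
      (.fin (c₁ u))) = .fin (g u j))
    (ho : ∀ t j, o t j ∈ Fset p q)
    (hgo : ∀ t j, ∃ u₀, ∃ x ∈ Fset p q, (∀ u, u ≠ u₀ → w₂ t u * g u j = 0) ∧
      fmul p q (.fin (w₂ t u₀)) (.fin (g u₀ j)) = .fin x ∧
      fadd p q (.fin x) (.fin (c₂ t)) = .fin (o t j))
    (hXT : ∀ t j, X (eT t) j = 0) :
    (ffBlock m eH eT w₁ c₁ w₂ c₂).apply p q (toEF X) = toEF (upd eT o X) := by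
  unfold Block.apply
  rw [h.attnApply_zero hn (ffBlock m eH eT w₁ c₁ w₂ c₂) rfl rfl rfl rfl hX]
  have hhid : (fun (k : Fin r) (j : Fin n) => frelu p q
      ((madd p q (mmul p q (toEF (ffBlock m eH eT w₁ c₁ w₂ c₂).W1) (toEF X))
        (fun a _ => .fin ((ffBlock m eH eT w₁ c₁ w₂ c₂).b1 a))) k j))
      = toEF (Function.extend eH g 0) := by
    funext k j
    by_cases hk : ∃ u, eH u = k
    · obtain ⟨u, rfl⟩ := hk
      simp only [madd, mmul, toEF, ffBlock, hH.extend_apply]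
      exact hg u j
    · simp only [madd, mmul, toEF, ffBlock, Function.extend_apply' _ _ _ hk, Pi.zero_apply]
      rw [h.fsum_zero fun i => h.zero_fmul _, h.fadd_zero h.zero_valid, h.frelu_fin h.zero_mem,
        max_self]
  unfold ffApply
  rw [hhid]
  funext i j
  by_cases hi : ∃ t, eT t = i
  · obtain ⟨t, rfl⟩ := hi
    obtain ⟨u₀, x, hx, hz, hm, ha⟩ := hgo t j
    have hu₀ : fmul p q (.fin (Function.extend eH (w₂ t) 0 (eH u₀)))
        (.fin (Function.extend eH g 0 (eH u₀) j)) = .fin x := by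
      rw [hH.extend_apply, hH.extend_apply, hm]
    simp only [madd, mmul, toEF, ffBlock, upd_apply hT, hT.extend_apply, hXT]
    rw [h.fsum_single (eH u₀), hu₀, ha, h.zero_fadd (valid_fin (ho t j))]
    · intro k hk
      by_cases hu : ∃ u, eH u = k
      · obtain ⟨u, rfl⟩ := hu
        rw [hH.extend_apply, hH.extend_apply]
        simp only [fmul]
        rw [hz u fun hc => hk (hc ▸ rfl), h.rnd_of_mem h.zero_mem]
      · rw [Function.extend_apply' _ _ _ hu]
        exact h.zero_fmul _
    · rw [hu₀]; exact hx
  · have hi' : ∀ t, eT t ≠ i := by push Not at hi; exact hi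
    simp only [madd, mmul, toEF, ffBlock, Function.extend_apply' _ _ _ hi, Pi.zero_apply,
      upd_apply' o X hi']
    rw [h.fsum_zero fun i => h.zero_fmul _, h.fadd_zero h.zero_valid,
      h.fadd_zero (valid_fin (hX i j))]

lemma blocksApply_append {h m r d n : ℕ} (L₁ L₂ : List (Block h m r d)) (X : Mat d n) :
    blocksApply p q (L₁ ++ L₂) X = blocksApply p q L₂ (blocksApply p q L₁ X) :=
  List.foldl_append

noncomputable instance (p q : ℕ) : Fintype (Fset p q) := (Fset_finite p q).fintype

/-! ### Exact equality tests -/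

/-- A scaling factor that prevents overflow in the comparison of a float with `t`. -/
noncomputable def cmpScale (q : ℕ) (t : ℝ) : ℝ := if (2 : ℝ) ^ (emin q + 2) ≤ |t| then 1 / 2 else 1

/-- The rectified floating-point difference of `x` and `t`, after scaling. -/
noncomputable def cmpUnit (p q : ℕ) (x t : ℝ) : ℝ :=
  max (rd p q (rd p q (cmpScale q t * x) + -(cmpScale q t * t))) 0

lemma half_mem {x : ℝ} (hx : x ∈ Fset p q) (h1 : (2 : ℝ) ^ (emin q + 1) ≤ |x|) :
    1 / 2 * x ∈ Fset p q := by
  obtain ⟨m, e, h2, h3, h4, h5, rfl⟩ := hx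
  have hne : emin q + 1 ≤ e := by
    by_contra hc
    have he : e = emin q := by omega
    rw [abs_mul, abs_of_pos (two_zpow_pos _), he, ← Int.cast_abs] at h1
    have h6 : ((|m| : ℤ) : ℝ) < 2 ^ ((p : ℤ) + 1) := by
      have : |m| < 2 ^ (p + 1) := by omega
      have h7 : ((|m| : ℤ) : ℝ) < ((2 ^ (p + 1) : ℤ) : ℝ) := by exact_mod_cast this
      refine h7.trans_eq ?_
      push_cast
      rw [← zpow_natCast]; push_cast; rfl
    have h8 := mul_lt_mul_of_pos_right h6 (two_zpow_pos (emin q - (p : ℤ)))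
    rw [← two_zpow_add, show (p : ℤ) + 1 + (emin q - p) = emin q + 1 by ring] at h8
    linarith
  have := mem_Fset_of_abs_lt (p := p) (q := q) m (e - 1) h2 (by omega) (by omega)
  convert this using 1
  rw [show e - (p : ℤ) = 1 + (e - 1 - p) by ring, two_zpow_add, zpow_one]
  ring

lemma cmpScale_pos (q : ℕ) (t : ℝ) : 0 < cmpScale q t := by
  unfold cmpScale; split_ifs <;> norm_num

lemma cmpScale_neg (q : ℕ) (t : ℝ) : cmpScale q (-t) = cmpScale q t := by
  unfold cmpScale; rw [abs_neg]

lemma Adm.cmpScale_mem (h : Adm p q) (t : ℝ) : cmpScale q t ∈ Fset p q := by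
  have h7 := h.seven_le
  unfold cmpScale
  split_ifs
  · have := h.two_zpow_mem (k := -1) (by rw [emin_eq]; omega) (by omega)
    simpa [zpow_neg] using this
  · exact h.one_mem

lemma cmpScale_mul_mem {t : ℝ} (ht : t ∈ Fset p q) : cmpScale q t * t ∈ Fset p q := by
  unfold cmpScale
  split_ifs with hc
  · exact half_mem ht ((two_zpow_le (by omega)).trans hc)
  · rwa [one_mul]

lemma abs_cmpScale_mul_le {x : ℝ} (hx : x ∈ Fset p q) (t : ℝ) :
    |cmpScale q t * x| ≤ Omega p q := by
  have h1 := abs_le_Omega hx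
  have h2 := abs_nonneg x
  rw [abs_mul, abs_of_pos (cmpScale_pos q t)]
  unfold cmpScale
  split_ifs <;> linarith

lemma Adm.cmpScale_lt (h : Adm p q) {x t : ℝ} (hx : x ∈ Fset p q)
    (hxt : t < x) : cmpScale q t * t < rd p q (cmpScale q t * x) := by
  unfold cmpScale
  split_ifs with hc
  · by_cases hbig : (2 : ℝ) ^ (emin q + 1) ≤ |x|
    · rw [h.rd_self (half_mem hx hbig)]; linarith
    · push Not at hbig
      rw [abs_lt] at hbig
      have e1 : (2 : ℝ) ^ (emin q + 1) = 2 * 2 ^ emin q := by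
        rw [add_comm, two_zpow_add, zpow_one]
      have e2 : (2 : ℝ) ^ (emin q + 2) = 4 * 2 ^ emin q := by
        rw [add_comm, two_zpow_add]; norm_num
      have hpos := two_zpow_pos (emin q)
      have h7 := h.seven_le
      have hm : -(2 : ℝ) ^ emin q ∈ Fset p q :=
        neg_mem_Fset (h.two_zpow_mem (by omega) (by rw [emin_eq]; omega))
      have := h.le_rd (x := 1 / 2 * x) hm (by linarith)
      rcases abs_cases t with ⟨h3, h4⟩ | ⟨h3, h4⟩ <;> linarith
  · rw [one_mul, one_mul, h.rd_self hx]; exact hxt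

lemma Adm.abs_cmp_lt_thr (h : Adm p q) {x t : ℝ} (hx : x ∈ Fset p q) (ht : t ∈ Fset p q) :
    |rd p q (cmpScale q t * x) + -(cmpScale q t * t)| < thr p q := by
  have h2 := h.le_emax
  have h7 := h.seven_le
  by_cases hc : (2 : ℝ) ^ (emin q + 2) ≤ |t|
  · have hO : ∃ y ∈ Fset p q, Omega p q / 2 ≤ y ∧ y + Omega p q / 2 < thr p q := by
      have hz : Omega p q / 2 = ((2 ^ (p + 1) - 1 : ℤ) : ℝ) * 2 ^ (emax q - 1 - (p : ℤ)) := by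
        rw [Omega_eq, show emax q - (p : ℤ) = 1 + (emax q - 1 - p) by ring, two_zpow_add,
          zpow_one]
        ring
      refine ⟨Omega p q / 2, ?_, le_rfl, by linarith [Omega_lt_thr (p := p) (q := q)]⟩
      rw [hz]
      have : (1 : ℤ) ≤ 2 ^ (p + 1) := one_le_pow₀ (by norm_num)
      exact mem_Fset_of_abs_lt _ _ (by rw [abs_of_nonneg (by omega)])
        (by rw [emin_eq]; omega) (by omega)
    obtain ⟨y, hy, hy1, hy2⟩ := hO
    have hs : cmpScale q t = 1 / 2 := if_pos hc
    have hx' := abs_le.mp (abs_le_Omega hx)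
    have ht' := abs_le.mp (abs_le_Omega ht)
    have h3 := h.rd_le (x := 1 / 2 * x) hy (by linarith)
    have h4 := h.le_rd (x := 1 / 2 * x) (neg_mem_Fset hy) (by linarith)
    rw [hs, abs_lt]
    constructor <;> linarith
  · have hs : cmpScale q t = 1 := if_neg hc
    push Not at hc
    have h3 : (2 : ℝ) ^ (emin q + 2) ≤ 2 ^ (emax q - (p : ℤ) - 1) :=
      two_zpow_le (by rw [emin_eq]; omega)
    rw [hs, one_mul, one_mul, h.rd_self hx]
    have h4 := abs_le_Omega hx
    have h5 := abs_add_le x (-t)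
    rw [abs_neg] at h5
    unfold thr
    linarith

lemma Adm.cmpUnit_mem (h : Adm p q) (x t : ℝ) : cmpUnit p q x t ∈ Fset p q := by
  unfold cmpUnit
  rcases max_choice (rd p q (rd p q (cmpScale q t * x) + -(cmpScale q t * t))) 0 with hm | hm <;>
    rw [hm]
  exacts [h.rd_mem _, h.zero_mem]

lemma Adm.cmpUnit_eq_zero (h : Adm p q) {x t : ℝ} (ht : t ∈ Fset p q)
    (hxt : x ≤ t) : cmpUnit p q x t = 0 := by
  refine max_eq_right (h.rd_le h.zero_mem ?_)
  have := h.rd_le (cmpScale_mul_mem ht) (mul_le_mul_of_nonneg_left hxt (cmpScale_pos q t).le)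
  linarith

lemma Adm.le_cmpUnit (h : Adm p q) {x t : ℝ} (hx : x ∈ Fset p q) (ht : t ∈ Fset p q)
    (hxt : t < x) : (2 : ℝ) ^ (emin q - (p : ℤ)) ≤ cmpUnit p q x t := by
  have h7 := h.seven_le
  refine le_trans (h.le_rd (h.two_zpow_mem le_rfl (by rw [emin_eq]; omega)) ?_) (le_max_left _ _)
  have := omega_le_sub (h.rd_mem _) (cmpScale_mul_mem ht) (h.cmpScale_lt hx hxt)
  linarith

/-- The sign attached to a Boolean. -/
def sgn (b : Bool) : ℝ := if b then 1 else -1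

lemma sgn_mul_mem (b : Bool) {x : ℝ} (hx : x ∈ Fset p q) : sgn b * x ∈ Fset p q := by
  unfold sgn
  split_ifs
  · rwa [one_mul]
  · rw [neg_one_mul]; exact neg_mem_Fset hx

lemma cmpScale_sgn_mul (b : Bool) (t : ℝ) : cmpScale q (sgn b * t) = cmpScale q t := by
  unfold sgn
  split_ifs
  · rw [one_mul]
  · rw [neg_one_mul, cmpScale_neg]

lemma Adm.frelu_cmp (h : Adm p q) (b : Bool) {x t : ℝ} (hx : x ∈ Fset p q) (ht : t ∈ Fset p q) :
    frelu p q (fadd p q (fmul p q (.fin (sgn b * cmpScale q t)) (.fin x))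
      (.fin (-(sgn b * cmpScale q t * t)))) = .fin (cmpUnit p q (sgn b * x) (sgn b * t)) := by
  have hx' := sgn_mul_mem b hx
  have ht' := sgn_mul_mem b ht
  have h1 : fmul p q (.fin (sgn b * cmpScale q t)) (.fin x)
      = .fin (rd p q (cmpScale q (sgn b * t) * (sgn b * x))) := by
    rw [← rnd_of_abs_lt ((abs_cmpScale_mul_le hx' _).trans_lt Omega_lt_thr), cmpScale_sgn_mul]
    show rnd p q _ = _
    congr 1; ring
  have h2 := rnd_of_abs_lt (h.abs_cmp_lt_thr hx' ht')
  rw [h1, show sgn b * cmpScale q t * t = cmpScale q (sgn b * t) * (sgn b * t) by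
    rw [cmpScale_sgn_mul]; ring]
  show frelu p q (rnd p q _) = _
  rw [h2, h.frelu_fin (h.rd_mem _)]
  rfl

/-- A float that vanishes exactly when `x = t`. -/
noncomputable def cmpAbs (p q : ℕ) (x t : ℝ) : ℝ :=
  cmpUnit p q (sgn (decide (t < x)) * x) (sgn (decide (t < x)) * t)

lemma Adm.cmpUnit_sgn_eq_zero (h : Adm p q) {x t : ℝ} (ht : t ∈ Fset p q) {b : Bool}
    (hb : b ≠ decide (t < x)) : cmpUnit p q (sgn b * x) (sgn b * t) = 0 := by
  refine h.cmpUnit_eq_zero (sgn_mul_mem b ht) ?_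
  by_cases hc : t < x
  · have : b = false := by simpa [hc] using hb
    simp only [this, sgn]; simpa using hc.le
  · have : b = true := by simpa [hc] using hb
    simp only [this, sgn]; simpa using hc

lemma Adm.cmpAbs_self (h : Adm p q) {t : ℝ} (ht : t ∈ Fset p q) : cmpAbs p q t t = 0 :=
  h.cmpUnit_eq_zero (sgn_mul_mem _ ht) le_rfl

lemma Adm.le_cmpAbs (h : Adm p q) {x t : ℝ} (hx : x ∈ Fset p q) (ht : t ∈ Fset p q)
    (hxt : x ≠ t) : (2 : ℝ) ^ (emin q - (p : ℤ)) ≤ cmpAbs p q x t := by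
  refine h.le_cmpUnit (sgn_mul_mem _ hx) (sgn_mul_mem _ ht) ?_
  by_cases hc : t < x
  · simp [sgn, hc]
  · have := lt_of_le_of_ne (not_lt.mp hc) hxt
    simpa [sgn, hc] using this

/-- First clipping step: zero goes to one, floats that are not tiny stay away from one. -/
lemma Adm.exists_clip (h : Adm p q) {e : ℝ} (hle : e ≠ 0 → (2 : ℝ) ^ (emin q - (p : ℤ)) ≤ e) :
    ∃ v ∈ Fset p q, (e = 0 → v = 1) ∧ (e ≠ 0 → 0 ≤ v ∧ v ≤ 1 - 2 ^ (1 - (p : ℤ))) ∧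
      frelu p q (fadd p q (fmul p q (.fin (-2 ^ emax q)) (.fin e)) (.fin 1)) = .fin v := by
  have h2 := h.le_emax
  have h7 := h.seven_le
  have hp := h.1
  by_cases he : e = 0
  · refine ⟨1, h.one_mem, fun _ => rfl, fun hc => absurd he hc, ?_⟩
    rw [he, h.fmul_zero, h.zero_fadd (valid_fin h.one_mem), h.frelu_fin h.one_mem]
    simp
  specialize hle he
  have hpm : (2 : ℝ) ^ (1 - (p : ℤ)) ∈ Fset p q :=
    h.two_zpow_mem (by rw [emin_eq]; omega) (by omega)
  have hmul : -2 ^ emax q * e ≤ -(2 : ℝ) ^ (1 - (p : ℤ)) := by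
    have := mul_le_mul_of_nonneg_left hle (two_zpow_pos (emax q)).le
    rw [← two_zpow_add, show emax q + (emin q - (p : ℤ)) = 1 - p by rw [emin_eq]; ring] at this
    linarith
  have hlt1 : (2 : ℝ) ^ (1 - (p : ℤ)) < 1 := by
    have := two_zpow_lt (show 1 - (p : ℤ) < 0 by omega)
    simpa using this
  have htop : 1 - (2 : ℝ) ^ (1 - (p : ℤ)) ∈ Fset p q := by
    have hp2 : (2 : ℤ) ≤ 2 ^ p := by
      calc (2 : ℤ) = 2 ^ 1 := by norm_num
        _ ≤ 2 ^ p := pow_le_pow_right₀ (by norm_num) (by omega)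
    have := mem_Fset_of_abs_lt (p := p) (q := q) (2 ^ p - 2) 0
      (by rw [abs_of_nonneg (by omega), pow_succ]; omega) (by rw [emin_eq]; omega) (by omega)
    convert this using 1
    have h3 : (2 : ℝ) ^ (p : ℕ) ≠ 0 := by positivity
    rw [sub_eq_add_neg 1 (p : ℤ), two_zpow_add, zero_sub, zpow_neg, zpow_natCast, zpow_one]
    push_cast
    field_simp
  have hthr : (1 : ℝ) < thr p q := (le_abs_self _).trans_lt (abs_lt_thr h.one_mem)
  by_cases hover : -2 ^ emax q * e ≤ -thr p q
  · refine ⟨0, h.zero_mem, fun hc => absurd hc he, fun _ => ⟨le_rfl, by linarith⟩, ?_⟩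
    have : fmul p q (.fin (-2 ^ emax q)) (.fin e) = .ninf := by
      show rnd p q _ = _
      unfold rnd
      have hpos := two_zpow_pos (1 - (p : ℤ))
      rw [if_neg (by push Not; linarith), if_pos hover]
    rw [this]
    rfl
  · push Not at hover
    have hpos := two_zpow_pos (1 - (p : ℤ))
    have hm : fmul p q (.fin (-2 ^ emax q)) (.fin e) = .fin (rd p q (-2 ^ emax q * e)) :=
      rnd_of_abs_lt (abs_lt.mpr ⟨hover, by linarith⟩)
    have hr := h.rd_le (neg_mem_Fset hpm) hmul
    have hrl := (abs_lt.mp (abs_lt_thr (h.rd_mem (-2 ^ emax q * e)))).1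
    have hs : fadd p q (.fin (rd p q (-2 ^ emax q * e))) (.fin 1)
        = .fin (rd p q (rd p q (-2 ^ emax q * e) + 1)) :=
      rnd_of_abs_lt (abs_lt.mpr ⟨by linarith, by linarith⟩)
    have hr2 := h.rd_le (x := rd p q (-2 ^ emax q * e) + 1) htop (by linarith)
    refine ⟨max (rd p q (rd p q (-2 ^ emax q * e) + 1)) 0, ?_, fun hc => absurd hc he,
      fun _ => ⟨le_max_right _ _, max_le hr2 (by linarith)⟩, ?_⟩
    · rcases max_choice (rd p q (rd p q (-2 ^ emax q * e) + 1)) 0 with hm | hm <;> rw [hm]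
      exacts [h.rd_mem _, h.zero_mem]
    · rw [hm, hs, h.frelu_fin (h.rd_mem _)]

/-- Second clipping step. -/
lemma Adm.clip_two (h : Adm p q) {v : ℝ} (hv : v = 1 ∨ 0 ≤ v ∧ v ≤ 1 - 2 ^ (1 - (p : ℤ))) :
    frelu p q (fadd p q (fmul p q (.fin (2 ^ (p : ℤ))) (.fin v)) (.fin (1 - 2 ^ (p : ℤ))))
      = .fin (if v = 1 then 1 else 0) := by
  have h2 := h.le_emax
  have h7 := h.seven_le
  have hp := h.1
  have hpp : (2 : ℝ) ^ (p : ℤ) ∈ Fset p q := h.two_zpow_mem (by rw [emin_eq]; omega) (by omega)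
  rcases hv with hv | ⟨hv0, hv1⟩
  · rw [if_pos hv, hv, h.fmul_one hpp]
    show frelu p q (rnd p q _) = _
    rw [add_sub_cancel, h.rnd_of_mem h.one_mem, h.frelu_fin h.one_mem]
    simp
  · have hne : v ≠ 1 := by
      have := two_zpow_pos (1 - (p : ℤ))
      linarith
    rw [if_neg hne]
    have hpow2 : (2 : ℝ) ≤ 2 ^ (p : ℤ) := by
      simpa using two_zpow_le (show (1 : ℤ) ≤ p by omega)
    have hm2 : (2 : ℝ) ^ (p : ℤ) * v ≤ 2 ^ (p : ℤ) - 2 := by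
      have := mul_le_mul_of_nonneg_left hv1 (two_zpow_pos (p : ℤ)).le
      rw [mul_sub, ← two_zpow_add, show (p : ℤ) + (1 - p) = 1 by ring, zpow_one] at this
      linarith
    have hm0 : 0 ≤ (2 : ℝ) ^ (p : ℤ) * v := by positivity
    have htop : (2 : ℝ) ^ (p : ℤ) - 2 ∈ Fset p q := by
      have hp2 : (2 : ℤ) ≤ 2 ^ p := by
        calc (2 : ℤ) = 2 ^ 1 := by norm_num
          _ ≤ 2 ^ p := pow_le_pow_right₀ (by norm_num) (by omega)
      have := mem_Fset_of_abs_lt (p := p) (q := q) (2 ^ p - 2) p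
        (by rw [abs_of_nonneg (by omega), pow_succ]; omega) (by rw [emin_eq]; omega) (by omega)
      simpa using this
    have hlt := (abs_lt.mp (abs_lt_thr hpp)).2
    have e1 : fmul p q (.fin (2 ^ (p : ℤ))) (.fin v) = .fin (rd p q (2 ^ (p : ℤ) * v)) :=
      rnd_of_abs_lt (abs_lt.mpr ⟨by linarith, by linarith⟩)
    have h3 := h.rd_le htop hm2
    have h4 := h.le_rd h.zero_mem hm0
    have e2 : fadd p q (.fin (rd p q (2 ^ (p : ℤ) * v))) (.fin (1 - 2 ^ (p : ℤ)))
        = .fin (rd p q (rd p q (2 ^ (p : ℤ) * v) + (1 - 2 ^ (p : ℤ)))) :=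
      rnd_of_abs_lt (abs_lt.mpr ⟨by linarith, by linarith⟩)
    rw [e1, e2, h.frelu_fin (h.rd_mem _), max_eq_right (h.rd_le h.zero_mem (by linarith))]

/-- The floating-point conjunction of negated indicators. -/
lemma Adm.frelu_nor (h : Adm p q) {N : ℕ} {v : Fin N → EF}
    (hv : ∀ i, v i = .fin 0 ∨ v i = .fin (-1)) :
    frelu p q (fadd p q (fsum p q v) (.fin 1)) = .fin (if ∀ i, v i = .fin 0 then 1 else 0) := by
  split_ifs with hall
  · rw [h.fsum_zero hall, h.zero_fadd (valid_fin h.one_mem), h.frelu_fin h.one_mem]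
    simp
  · have hm1 : (-1 : ℝ) ∈ Fset p q := neg_mem_Fset h.one_mem
    let P : EF → Prop := fun a => a = .ninf ∨ ∃ r ∈ Fset p q, r ≤ -1 ∧ a = .fin r
    have hstep : ∀ a, P a ∨ a = .fin 0 → P (fadd p q a (.fin (-1))) := by
      rintro a ((rfl | ⟨r, hr, hr1, rfl⟩) | rfl)
      · exact Or.inl rfl
      · have hthr : (0 : ℝ) < thr p q := (abs_nonneg _).trans_lt (abs_lt_thr h.one_mem)
        by_cases hc : r + -1 ≤ -thr p q
        · left
          show rnd p q _ = _
          unfold rnd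
          rw [if_neg (by push Not; linarith), if_pos hc]
        · right
          push Not at hc
          exact ⟨_, h.rd_mem _, h.rd_le hm1 (by linarith),
            rnd_of_abs_lt (abs_lt.mpr ⟨hc, by linarith⟩)⟩
      · exact Or.inr ⟨-1, hm1, le_rfl, h.zero_fadd (valid_fin hm1)⟩
    have hval : ∀ a, P a → a.Valid p q := by
      rintro a (rfl | ⟨r, hr, -, rfl⟩)
      · trivial
      · exact hr
    have hfold : ∀ (l : List EF) (a : EF), (∀ x ∈ l, x = .fin 0 ∨ x = .fin (-1)) →
        (P a ∨ a = .fin 0) → (P a ∨ .fin (-1) ∈ l) → P (l.foldl (fadd p q) a) := by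
      intro l
      induction l with
      | nil => intro a _ _ h3; simpa using h3
      | cons x l ih =>
        intro a h1 h2 h3
        rw [List.foldl_cons]
        have hl : ∀ y ∈ l, y = .fin 0 ∨ y = .fin (-1) := fun y hy =>
          h1 y (List.mem_cons_of_mem _ hy)
        rcases h1 x List.mem_cons_self with hx | hx
        · have ha : fadd p q a x = a := by
            rw [hx]
            refine h.fadd_zero ?_
            rcases h2 with h2 | h2
            · exact hval a h2
            · rw [h2]; exact h.zero_valid
          rw [ha]
          refine ih a hl h2 (h3.imp_right fun h3 => ?_)
          rcases List.mem_cons.mp h3 with h4 | h4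
          · rw [hx] at h4
            injection h4 with h4
            norm_num at h4
          · exact h4
        · rw [hx]
          exact ih _ hl (Or.inl (hstep a h2)) (Or.inl (hstep a h2))
    have hP : P (fsum p q v) := by
      unfold fsum
      rw [h.fsuml_eq_foldl]
      · push Not at hall
        obtain ⟨i, hi⟩ := hall
        refine hfold _ _ (by simpa using hv) (Or.inr rfl) (Or.inr ?_)
        exact List.mem_map.mpr ⟨i, List.mem_finRange i, (hv i).resolve_left hi⟩
      · simp only [List.mem_map]
        rintro x ⟨i, -, rfl⟩
        rcases hv i with hi | hi <;> rw [hi]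
        exacts [h.zero_valid, valid_fin hm1]
    rcases hP with hP | ⟨r, hr, hr1, hP⟩
    · rw [hP]; rfl
    · rw [hP]
      have hrl := (abs_lt.mp (abs_lt_thr hr)).1
      have hthr : (0 : ℝ) < thr p q := (abs_nonneg _).trans_lt (abs_lt_thr h.one_mem)
      have e : fadd p q (.fin r) (.fin 1) = .fin (rd p q (r + 1)) :=
        rnd_of_abs_lt (abs_lt.mpr ⟨by linarith, by linarith⟩)
      rw [e, h.frelu_fin (h.rd_mem _), max_eq_right (h.rd_le h.zero_mem (by linarith))]

/-! ### Feed-forward memory -/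

lemma Adm.neg_one_mem (h : Adm p q) : (-1 : ℝ) ∈ Fset p q := neg_mem_Fset h.one_mem

lemma Adm.two_zpow_p_mem (h : Adm p q) : (2 : ℝ) ^ (p : ℤ) ∈ Fset p q :=
  h.two_zpow_mem (by rw [emin_eq]; have := h.seven_le; omega) (by have := h.le_emax; omega)

lemma Adm.one_sub_two_zpow_mem (h : Adm p q) : 1 - (2 : ℝ) ^ (p : ℤ) ∈ Fset p q := by
  have h2 := h.le_emax
  have h7 := h.seven_le
  have hp2 : (1 : ℤ) ≤ 2 ^ p := one_le_pow₀ (by norm_num)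
  have := mem_Fset_of_abs_lt (p := p) (q := q) (1 - 2 ^ p) p
    (by rw [abs_of_nonpos (by omega), pow_succ]; omega) (by rw [emin_eq]; omega) (by omega)
  simpa using this

lemma single_mem {d : ℕ} {x : ℝ} (h0 : (0 : ℝ) ∈ Fset p q) (hx : x ∈ Fset p q) (i j : Fin d) :
    (Pi.single i x : Fin d → ℝ) j ∈ Fset p q := by
  rw [Pi.single_apply]
  split_ifs
  exacts [hx, h0]

lemma Adm.fsum_single_weight (h : Adm p q) {d : ℕ} {w : ℝ} (i₀ : Fin d) (x : Fin d → ℝ) :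
    fsum p q (fun i => fmul p q (.fin ((Pi.single i₀ w : Fin d → ℝ) i)) (.fin (x i)))
      = fmul p q (.fin w) (.fin (x i₀)) := by
  rw [h.fsum_single i₀]
  · rw [Pi.single_eq_same]
  · intro i hi
    rw [Pi.single_eq_of_ne hi]
    exact h.zero_fmul _
  · exact h.rnd_valid _

/-- A feed-forward block acting on single registers: each target register receives a function of
one source register. -/
noncomputable def diagBlock (m : ℕ) {r d : ℕ} {T : Type} (eH : T → Fin r) (src dst : T → Fin d)
    (w c w' c' : ℝ) : Block 1 m r d :=
  ffBlock m eH dst (fun t => Pi.single (src t) w) (fun _ => c) (fun t u => if u = t then w' else 0)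
    (fun _ => c')

lemma Adm.diagBlock_valid (h : Adm p q) {m r d : ℕ} {T : Type} {eH : T → Fin r}
    {src dst : T → Fin d} (hH : Function.Injective eH) (hT : Function.Injective dst)
    {w c w' c' : ℝ} (hw : w ∈ Fset p q) (hc : c ∈ Fset p q) (hw' : w' ∈ Fset p q)
    (hc' : c' ∈ Fset p q) : (diagBlock m eH src dst w c w' c').Valid p q := by
  refine h.ffBlock_valid hH hT (fun u i => single_mem h.zero_mem hw _ _) (fun _ => hc) ?_
    (fun _ => hc')
  intro t u
  split_ifs
  exacts [hw', h.zero_mem]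

lemma Adm.diagBlock_apply (h : Adm p q) {m r d n : ℕ} (hn : 0 < n) {T : Type} {eH : T → Fin r}
    {src dst : T → Fin d} (hH : Function.Injective eH) (hT : Function.Injective dst)
    {w c w' c' : ℝ} {X : Fin d → Fin n → ℝ} (hX : RealMatFin p q X) {g o : T → Fin n → ℝ}
    (ho : ∀ t j, o t j ∈ Fset p q)
    (hg : ∀ t j, frelu p q (fadd p q (fmul p q (.fin w) (.fin (X (src t) j))) (.fin c))
      = .fin (g t j))
    (hgo : ∀ t j, ∃ x ∈ Fset p q, fmul p q (.fin w') (.fin (g t j)) = .fin x ∧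
      fadd p q (.fin x) (.fin c') = .fin (o t j))
    (hXT : ∀ t j, X (dst t) j = 0) :
    (diagBlock m eH src dst w c w' c').apply p q (toEF X) = toEF (upd dst o X) := by
  refine h.ffBlock_apply hn hH hT hX (g := g) (fun u j => ?_) ho (fun t j => ?_) hXT
  · rw [← hg u j, ← h.fsum_single_weight (src u) (fun i => X i j)]
  · obtain ⟨x, hx, h1, h2⟩ := hgo t j
    exact ⟨t, x, hx, fun u hu => by rw [if_neg hu, zero_mul], by rw [if_pos rfl, h1], h2⟩

/-- Feed-forward blocks can store an arbitrary function of the contents of some registers. -/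
theorem Adm.exists_memory (h : Adm p q) (m : ℕ) {r d : ℕ} {A O : Type}
    {reg : (A ⊕ O) ⊕ (Fin 3 × A × Fset p q) → Fin d} (hreg : Function.Injective reg)
    {eU : A × Fset p q × Bool → Fin r} (hU : Function.Injective eU)
    {eC : (A → Fset p q) → Fin r} (hC : Function.Injective eC)
    (G : (A → Fset p q) → O → Fset p q) :
    ∃ L : List (Block 1 m r d), L ≠ [] ∧ (∀ B ∈ L, B.Valid p q) ∧
      ∀ (n : ℕ) (_ : 0 < n) (X : Fin d → Fin n → ℝ) (hX : RealMatFin p q X),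
        (∀ o j, X (reg (.inl (.inr o))) j = 0) → (∀ s j, X (reg (.inr s)) j = 0) →
        ∃ X' : Fin d → Fin n → ℝ, RealMatFin p q X' ∧
          blocksApply p q L (toEF X) = toEF X' ∧
          (∀ i, (∀ o, reg (.inl (.inr o)) ≠ i) → (∀ s, reg (.inr s) ≠ i) → X' i = X i) ∧
          ∀ o j, X' (reg (.inl (.inr o))) j =
            G (fun a => ⟨X (reg (.inl (.inl a))) j, hX _ _⟩) o := by
  have h2 := h.le_emax
  have h7 := h.seven_le
  have hmax : -(2 : ℝ) ^ emax q ∈ Fset p q :=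
    neg_mem_Fset (h.two_zpow_mem (by rw [emin_eq]; omega) le_rfl)
  let rA : A → Fin d := fun a => reg (.inl (.inl a))
  let rO : O → Fin d := fun o => reg (.inl (.inr o))
  let rS : Fin 3 → A × Fset p q → Fin d := fun k t => reg (.inr (k, t))
  let eT : A × Fset p q → Fin r := fun t => eU (t.1, t.2, true)
  have hrO : Function.Injective rO := fun a b hab => by simpa using hreg hab
  have hrS : ∀ k, Function.Injective (rS k) := fun k a b hab => by simpa using hreg hab
  have hSS : ∀ k l s t, k ≠ l → rS k s ≠ rS l t := fun k l s t hkl hc => by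
    have := hreg hc
    simp at this
    exact hkl this.1
  have hSA : ∀ k s a, rS k s ≠ rA a := fun k s a hc => by simpa using hreg hc
  have hSO : ∀ k s o, rS k s ≠ rO o := fun k s o hc => by simpa using hreg hc
  have heT : Function.Injective eT := fun a b hab => by
    have := hU hab
    simp at this
    exact Prod.ext this.1 this.2
  let B₁ : Block 1 m r d := ffBlock m eU (rS 0)
    (fun u => Pi.single (rA u.1) (sgn u.2.2 * cmpScale q u.2.1))
    (fun u => -(sgn u.2.2 * cmpScale q u.2.1 * u.2.1))
    (fun t u => if (u.1, u.2.1) = t then 1 else 0) (fun _ => 0)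
  let B₂ : Block 1 m r d := diagBlock m eT (rS 0) (rS 1) (-2 ^ emax q) 1 1 0
  let B₃ : Block 1 m r d := diagBlock m eT (rS 1) (rS 2) (2 ^ (p : ℤ)) (1 - 2 ^ (p : ℤ)) (-1) 1
  let B₄ : Block 1 m r d := ffBlock m eC rO
    (fun c i => if ∃ a, rS 2 (a, c a) = i then -1 else 0) (fun _ => 1)
    (fun o c => (G c o : ℝ)) (fun _ => 0)
  refine ⟨[B₁, B₂, B₃, B₄], by simp, ?_, ?_⟩
  · have hB₁ : B₁.Valid p q := by
      refine h.ffBlock_valid hU (hrS 0) (fun u i => single_mem h.zero_mem ?_ _ _) (fun u => ?_)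
        (fun t u => ?_) (fun _ => h.zero_mem)
      · exact sgn_mul_mem _ (h.cmpScale_mem _)
      · rw [mul_assoc]
        exact neg_mem_Fset (sgn_mul_mem _ (cmpScale_mul_mem u.2.1.2))
      · split_ifs
        exacts [h.one_mem, h.zero_mem]
    have hB₂ : B₂.Valid p q := h.diagBlock_valid heT (hrS 1) hmax h.one_mem h.one_mem h.zero_mem
    have hB₃ : B₃.Valid p q :=
      h.diagBlock_valid heT (hrS 2) h.two_zpow_p_mem h.one_sub_two_zpow_mem h.neg_one_mem h.one_mem
    have hB₄ : B₄.Valid p q := by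
      refine h.ffBlock_valid hC hrO (fun u i => ?_) (fun _ => h.one_mem) (fun o c => (G c o).2)
        (fun _ => h.zero_mem)
      split_ifs
      exacts [h.neg_one_mem, h.zero_mem]
    simp only [List.mem_cons, List.not_mem_nil, or_false]
    rintro B (rfl | rfl | rfl | rfl) <;> assumption
  intro n hn X hX hO hS
  have hcmp : ∀ a j (t : Fset p q), cmpAbs p q (X (rA a) j) t ∈ Fset p q :=
    fun a j t => h.cmpUnit_mem _ _
  let o₁ : A × Fset p q → Fin n → ℝ := fun t j => cmpAbs p q (X (rA t.1) j) t.2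
  let X₁ := upd (rS 0) o₁ X
  have hX₁ : RealMatFin p q X₁ := upd_fin (hrS 0) (fun t j => hcmp _ _ _) hX
  have e₁ : B₁.apply p q (toEF X) = toEF X₁ := by
    refine h.ffBlock_apply hn hU (hrS 0) hX (g := fun u j =>
      cmpUnit p q (sgn u.2.2 * X (rA u.1) j) (sgn u.2.2 * u.2.1)) (fun u j => ?_)
      (fun t j => hcmp _ _ _) (fun t j => ?_) (fun t j => hS _ _)
    · rw [h.fsum_single_weight (rA u.1) (fun i => X i j)]
      exact h.frelu_cmp _ (hX _ _) u.2.1.2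
    · refine ⟨(t.1, t.2, decide ((t.2 : ℝ) < X (rA t.1) j)), o₁ t j, hcmp _ _ _,
        fun u hu => ?_, ?_, h.fadd_zero (valid_fin (hcmp _ _ _))⟩
      · obtain ⟨a, s, b⟩ := u
        by_cases ht : (a, s) = t
        · subst ht
          have hb : b ≠ decide ((s : ℝ) < X (rA a) j) := fun hc => hu (by rw [hc])
          simp only [h.cmpUnit_sgn_eq_zero s.2 hb, mul_zero]
        · simp only [if_neg ht, zero_mul]
      · rw [if_pos rfl]
        exact h.one_fmul (hcmp _ _ _)
  have hX₁0 : ∀ t, X₁ (rS 0 t) = o₁ t := fun t => upd_apply (hrS 0) _ _ t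
  have hclip := fun (t : A × Fset p q) (j : Fin n) => h.exists_clip (e := o₁ t j) fun hne =>
    h.le_cmpAbs (hX _ _) t.2.2 fun hc => hne (by
      show cmpAbs p q (X (rA t.1) j) t.2 = 0
      rw [hc]; exact h.cmpAbs_self t.2.2)
  choose o₂ ho₂ hv₁ hv₂ hv₃ using hclip
  let X₂ := upd (rS 1) o₂ X₁
  have hX₂ : RealMatFin p q X₂ := upd_fin (hrS 1) ho₂ hX₁
  have e₂ : B₂.apply p q (toEF X₁) = toEF X₂ := by
    refine h.diagBlock_apply hn heT (hrS 1) hX₁ (g := o₂) ho₂ (fun t j => ?_) (fun t j => ?_)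
      (fun t j => ?_)
    · rw [hX₁0]; exact hv₃ t j
    · exact ⟨o₂ t j, ho₂ t j, h.one_fmul (ho₂ t j), h.fadd_zero (valid_fin (ho₂ t j))⟩
    · rw [show X₁ (rS 1 t) = X (rS 1 t) from upd_apply' _ _ fun s => hSS _ _ _ _ (by decide)]
      exact hS _ _
  have hX₂1 : ∀ t, X₂ (rS 1 t) = o₂ t := fun t => upd_apply (hrS 1) _ _ t
  let o₃ : A × Fset p q → Fin n → ℝ := fun t j => if X (rA t.1) j = t.2 then 0 else 1
  have ho₃ : ∀ t j, o₃ t j ∈ Fset p q := fun t j => by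
    show (if _ then _ else _) ∈ _
    split_ifs
    exacts [h.zero_mem, h.one_mem]
  have ho₂1 : ∀ t j, o₂ t j = 1 ↔ X (rA t.1) j = t.2 := by
    intro t j
    have hpos := two_zpow_pos (1 - (p : ℤ))
    constructor
    · intro hc
      by_contra hne
      have h3 := h.le_cmpAbs (hX (rA t.1) j) t.2.2 hne
      have h4 := two_zpow_pos (emin q - (p : ℤ))
      have h5 := (hv₂ t j (h4.trans_le h3).ne').2
      linarith
    · intro hc
      refine hv₁ t j ?_
      show cmpAbs p q (X (rA t.1) j) t.2 = 0
      rw [hc]; exact h.cmpAbs_self t.2.2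
  let X₃ := upd (rS 2) o₃ X₂
  have hX₃ : RealMatFin p q X₃ := upd_fin (hrS 2) ho₃ hX₂
  have e₃ : B₃.apply p q (toEF X₂) = toEF X₃ := by
    refine h.diagBlock_apply hn heT (hrS 2) hX₂
      (g := fun t j => if o₂ t j = 1 then 1 else 0) ho₃ (fun t j => ?_) (fun t j => ?_)
      (fun t j => ?_)
    · rw [hX₂1]
      refine h.clip_two ?_
      by_cases hc : o₁ t j = 0
      · exact Or.inl (hv₁ t j hc)
      · exact Or.inr (hv₂ t j hc)
    · by_cases hc : X (rA t.1) j = t.2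
      · refine ⟨-1, h.neg_one_mem, ?_, ?_⟩
        · simp only [(ho₂1 t j).mpr hc, if_true]
          exact h.fmul_one h.neg_one_mem
        · show rnd p q _ = .fin (if _ then _ else _)
          rw [if_pos hc, neg_add_cancel, h.rnd_of_mem h.zero_mem]
      · refine ⟨0, h.zero_mem, ?_, ?_⟩
        · simp only [(ho₂1 t j).not.mpr hc, if_false]
          exact h.fmul_zero _
        · show _ = EF.fin (if _ then _ else _)
          rw [if_neg hc]
          exact h.zero_fadd (valid_fin h.one_mem)
    · rw [show X₂ (rS 2 t) = X₁ (rS 2 t) from upd_apply' _ _ fun s => hSS _ _ _ _ (by decide),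
        show X₁ (rS 2 t) = X (rS 2 t) from upd_apply' _ _ fun s => hSS _ _ _ _ (by decide)]
      exact hS _ _
  have hX₃2 : ∀ t, X₃ (rS 2 t) = o₃ t := fun t => upd_apply (hrS 2) _ _ t
  have hkeep : ∀ i, (∀ s, reg (.inr s) ≠ i) → X₃ i = X i := by
    intro i hi
    rw [show X₃ i = X₂ i from upd_apply' _ _ fun t => hi _,
      show X₂ i = X₁ i from upd_apply' _ _ fun t => hi _]
    exact upd_apply' _ _ fun t => hi _
  let cont : Fin n → A → Fset p q := fun j a => ⟨X (rA a) j, hX _ _⟩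
  let o₄ : O → Fin n → ℝ := fun o j => G (cont j) o
  have ho₄ : ∀ o j, o₄ o j ∈ Fset p q := fun o j => (G _ _).2
  have e₄ : B₄.apply p q (toEF X₃) = toEF (upd rO o₄ X₃) := by
    refine h.ffBlock_apply hn hC hrO hX₃ (g := fun c j => if c = cont j then 1 else 0)
      (fun c j => ?_) ho₄ (fun o j => ?_) (fun o j => ?_)
    · have hval : ∀ i, fmul p q (.fin (if ∃ a, rS 2 (a, c a) = i then -1 else 0)) (.fin (X₃ i j))
          = .fin (if ∃ a, rS 2 (a, c a) = i ∧ X (rA a) j ≠ c a then -1 else 0) := by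
        intro i
        by_cases hi : ∃ a, rS 2 (a, c a) = i
        · rw [if_pos hi]
          obtain ⟨a, rfl⟩ := hi
          rw [hX₃2]
          by_cases hc : X (rA a) j = c a
          · rw [if_neg]
            · show fmul p q _ (.fin (if _ then _ else _)) = _
              rw [if_pos hc]
              exact h.fmul_zero _
            · rintro ⟨b, hb, hb'⟩
              have := hrS 2 hb
              simp only [Prod.mk.injEq] at this
              obtain ⟨rfl, -⟩ := this
              exact hb' hc
          · rw [if_pos ⟨a, rfl, hc⟩]
            show fmul p q _ (.fin (if _ then _ else _)) = _
            rw [if_neg hc]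
            exact h.fmul_one h.neg_one_mem
        · rw [if_neg hi, if_neg fun ⟨a, ha, _⟩ => hi ⟨a, ha⟩]
          exact h.zero_fmul _
      simp only [hval]
      rw [h.frelu_nor]
      · congr 1
        refine if_congr ?_ rfl rfl
        constructor
        · intro hz
          funext a
          by_contra hne
          have := hz (rS 2 (a, c a))
          rw [if_pos ⟨a, rfl, fun hc => hne (Subtype.ext hc.symm)⟩] at this
          injection this with this
          norm_num at this
        · rintro rfl i
          rw [if_neg]
          rintro ⟨a, -, ha⟩
          exact ha rfl
      · intro i
        split_ifs
        exacts [Or.inr rfl, Or.inl rfl]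
    · refine ⟨cont j, o₄ o j, ho₄ o j, fun c hc => by rw [if_neg hc, mul_zero], ?_,
        h.fadd_zero (valid_fin (ho₄ o j))⟩
      rw [if_pos rfl]
      exact h.fmul_one (ho₄ o j)
    · rw [hkeep _ fun s => hSO s.1 s.2 o]
      exact hO _ _
  refine ⟨upd rO o₄ X₃, upd_fin hrO ho₄ hX₃, ?_, fun i hi hi' => ?_, fun o j => ?_⟩
  · simp only [blocksApply, List.foldl_cons, List.foldl_nil, e₁, e₂, e₃, e₄]
  · rw [upd_apply' _ _ hi, hkeep i hi']
  · exact congrFun (upd_apply hrO o₄ X₃ o) j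

/-! ### Features computed by uniform attention -/

/-- The three values that mark the columns used by a feature. -/
def code (a b : ℝ) : Option (Fin 3) → ℝ
  | none => 0
  | some t => ![a, -a, b] t

/-- The rounding behaviour of the marks after weighting: `b` is absorbed by `±a`. -/
structure Absorbs (p q : ℕ) (a b : ℝ) : Prop where
  mem_left : a ∈ Fset p q
  mem_right : b ∈ Fset p q
  right_pos : 0 < b
  right_lt : b < a
  add_right : fadd p q (.fin a) (.fin b) = .fin a
  neg_add_right : fadd p q (.fin (-a)) (.fin b) = .fin (-a)

lemma Adm.exists_code (h : Adm p q) {s : ℝ} (hs : s ∈ Fset p q)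
    (hs1 : (2 : ℝ) ^ (-(p : ℤ) - 2) ≤ s) (hs2 : s ≤ 1) :
    ∃ α β a b : ℝ, (∀ t, code α β t ∈ Fset p q) ∧ Absorbs p q a b ∧
      ∀ t, fmul p q (.fin (code α β t)) (.fin s) = .fin (code a b t) := by
  have h2 := h.le_emax
  have h7 := h.seven_le
  have hspos : 0 < s := (two_zpow_pos _).trans_le hs1
  have hα : (2 : ℝ) ^ emax q ∈ Fset p q := h.two_zpow_mem (by rw [emin_eq]; omega) le_rfl
  have ha : (2 : ℝ) ^ emax q * s ∈ Fset p q := by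
    obtain ⟨m, e, h3, h4, h5, h6, rfl⟩ := hs
    have he : e ≤ 0 := by
      by_contra hc
      push Not at hc
      have hm : (2 : ℤ) ^ p ≤ |m| := h6.resolve_right (by rw [emin_eq]; omega)
      have hm' : (2 : ℝ) ^ (p : ℤ) ≤ |(m : ℝ)| := by
        rw [zpow_natCast]; exact_mod_cast hm
      have h8 := mul_le_mul_of_nonneg_right hm' (two_zpow_pos (e - p)).le
      have h10 : |(m : ℝ)| * 2 ^ (e - (p : ℤ)) = m * 2 ^ (e - (p : ℤ)) := by
        rw [← abs_of_pos hspos, abs_mul, abs_of_pos (two_zpow_pos _)]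
      rw [← two_zpow_add, add_sub_cancel, h10] at h8
      have h9 := two_zpow_lt hc
      rw [zpow_zero] at h9
      linarith
    have := mem_Fset_of_abs_lt (p := p) (q := q) m (e + emax q) h3
      (by rw [emin_eq] at *; omega) (by omega)
    convert this using 1
    rw [show e + emax q - (p : ℤ) = emax q + (e - p) by ring, two_zpow_add]
    ring
  have ha1 : 1 ≤ (2 : ℝ) ^ emax q * s := by
    have h3 := mul_le_mul_of_nonneg_left hs1 (two_zpow_pos (emax q)).le
    rw [← two_zpow_add] at h3
    have h4 := two_zpow_le (show (0 : ℤ) ≤ emax q + (-(p : ℤ) - 2) by omega)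
    rw [zpow_zero] at h4
    linarith
  obtain ⟨k, hk1, hk2⟩ := exists_mem_Ico_zpow hspos (one_lt_two (α := ℝ))
  have hk0 : k ≤ 0 := by
    by_contra hc
    push Not at hc
    have := two_zpow_lt hc
    rw [zpow_zero] at this
    linarith
  have hkp : -(p : ℤ) - 2 ≤ k := by
    by_contra hc
    push Not at hc
    have := two_zpow_le (show k + 1 ≤ -(p : ℤ) - 2 by omega)
    linarith
  have hβ : (2 : ℝ) ^ (emin q - p - k) ∈ Fset p q :=
    h.two_zpow_mem (by omega) (by rw [emin_eq]; omega)
  have hb1 : (2 : ℝ) ^ (emin q - (p : ℤ)) ≤ 2 ^ (emin q - p - k) * s := by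
    have := mul_le_mul_of_nonneg_left hk1 (two_zpow_pos (emin q - p - k)).le
    rwa [← two_zpow_add, sub_add_cancel] at this
  have hb2 : (2 : ℝ) ^ (emin q - p - k) * s ≤ 2 ^ (emin q - (p : ℤ) + 1) := by
    have := mul_le_mul_of_nonneg_left hk2.le (two_zpow_pos (emin q - p - k)).le
    rwa [← two_zpow_add, show emin q - p - k + (k + 1) = emin q - (p : ℤ) + 1 by ring] at this
  have hb3 := h.le_rd (h.two_zpow_mem le_rfl (by rw [emin_eq]; omega)) hb1
  have hb4 := h.rd_le (h.two_zpow_mem (by omega) (by rw [emin_eq]; omega)) hb2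
  have hb5 : (2 : ℝ) ^ (emin q - (p : ℤ) + 1) < 2 ^ (0 - (p : ℤ) - 2) :=
    two_zpow_lt (by rw [emin_eq]; omega)
  have hb6 : (2 : ℝ) ^ (0 - (p : ℤ) - 2) < 1 := by
    have := two_zpow_lt (show 0 - (p : ℤ) - 2 < 0 by omega)
    rwa [zpow_zero] at this
  have hb7 := (two_zpow_pos (emin q - (p : ℤ))).trans_le hb3
  set a := (2 : ℝ) ^ emax q * s with ha_def
  set b := rd p q (2 ^ (emin q - p - k) * s) with hb_def
  have hb : b ∈ Fset p q := h.rd_mem _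
  have hone := (le_abs_self _).trans_lt (abs_lt_thr h.one_mem)
  have habs : ∀ x ∈ Fset p q, 1 ≤ |x| → fadd p q (.fin x) (.fin b) = .fin x := by
    intro x hx hx1
    have hlt : |x + b| < thr p q := by
      have h3 := abs_le_Omega hx
      have h4 := abs_add_le x b
      rw [abs_of_pos hb7] at h4
      have h5 : (2 : ℝ) ^ (0 - (p : ℤ) - 2) ≤ 2 ^ (emax q - (p : ℤ) - 1) :=
        two_zpow_le (by omega)
      unfold thr
      linarith
    show rnd p q _ = _
    rw [rnd_of_abs_lt hlt, h.rd_add_of_abs_lt (E := 0) hx (by simpa using hx1)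
      (by rw [abs_of_pos hb7]; linarith)]
  refine ⟨2 ^ emax q, 2 ^ (emin q - p - k), a, b, ?_, ⟨ha, hb, hb7, by linarith,
    habs a ha (by rw [abs_of_pos] <;> linarith),
    habs (-a) (neg_mem_Fset ha) (by rw [abs_neg, abs_of_pos] <;> linarith)⟩, ?_⟩
  · rintro (_ | t)
    · exact h.zero_mem
    · fin_cases t
      exacts [hα, neg_mem_Fset hα, hβ]
  · rintro (_ | t)
    · exact h.zero_fmul _
    · fin_cases t
      · exact h.rnd_of_mem ha
      · show rnd p q (-2 ^ emax q * s) = .fin (-a)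
        rw [neg_mul, h.rnd_of_mem (neg_mem_Fset ha)]
      · refine rnd_of_abs_lt ?_
        show |(2 : ℝ) ^ (emin q - p - k) * s| < _
        rw [abs_of_pos (by positivity)]
        linarith

/-- The floating-point sum of a list of marks. -/
noncomputable def codeSum (p q : ℕ) (a b : ℝ) (l : List (Fin 3)) : EF :=
  (l.map fun t => EF.fin (code a b (some t))).foldl (fadd p q) (.fin 0)

lemma Adm.codeSum_spec (h : Adm p q) {a b : ℝ} (hab : Absorbs p q a b) {l : List (Fin 3)}
    (hl : l.Nodup) : (∃ z ∈ Fset p q, codeSum p q a b l = .fin z) ∧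
      ((∀ t ∈ l, t = 2) → (codeSum p q a b l = .fin b ↔ 2 ∈ l)) ∧
      ∀ {n : ℕ} (pos : Fin 3 → Fin n), 0 ∈ l → 1 ∈ l → 2 ∈ l →
        l.Pairwise (fun s t => pos s < pos t) →
        (codeSum p q a b l = .fin b ↔ pos 0 < pos 2 ∧ pos 1 < pos 2) := by
  obtain ⟨ha, hb, hb0, hba, e1, e2⟩ := hab
  have hna := neg_mem_Fset ha
  have e3 : fadd p q (.fin b) (.fin a) = .fin a :=
    (congrArg (rnd p q) (add_comm b a)).trans e1
  have e4 : fadd p q (.fin b) (.fin (-a)) = .fin (-a) :=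
    (congrArg (rnd p q) (add_comm b (-a))).trans e2
  have e5 : fadd p q (.fin a) (.fin (-a)) = .fin 0 := by
    simp only [fadd, add_neg_cancel, h.rnd_of_mem h.zero_mem]
  have e6 : fadd p q (.fin (-a)) (.fin a) = .fin 0 := by
    simp only [fadd, neg_add_cancel, h.rnd_of_mem h.zero_mem]
  have z1 := h.zero_fadd (valid_fin ha)
  have z2 := h.zero_fadd (valid_fin hb)
  have z3 := h.zero_fadd (valid_fin hna)
  have n1 : a ≠ b := ne_of_gt hba
  have n2 : -a ≠ b := by linarith
  have n3 : (0 : ℝ) ≠ b := hb0.ne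
  have h0 := h.zero_mem
  have hlen := hl.length_le_card
  rw [Fintype.card_fin] at hlen
  match l, hl, hlen with
  | [], _, _ => simp [codeSum, h0, n3]
  | [x], _, _ => fin_cases x <;> simp [codeSum, code, *]
  | [x, y], hl, _ => fin_cases x <;> fin_cases y <;> simp at hl <;> simp [codeSum, code, *]
  | [x, y, z], hl, _ =>
    fin_cases x <;> fin_cases y <;> fin_cases z <;> simp at hl <;> simp [codeSum, code, *] <;> omega

/-- The mark of a column `x` in the feature indexed by `k`. -/
noncomputable def tag {C : Type} (k : C × C × C) (x : C) : Option (Fin 3) :=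
  if x = k.2.2 then some 2 else if x = k.1 then some 0 else if x = k.2.1 then some 1 else none

/-- The marks that occur in a sequence of columns, in order. -/
noncomputable def tags {C : Type} {n : ℕ} (cols : Fin n → C) (k : C × C × C) : List (Fin 3) :=
  (List.finRange n).filterMap fun j => tag k (cols j)

lemma eq_of_tag_eq {C : Type} {k : C × C × C} {x : C} {t : Fin 3} (ht : tag k x = some t) :
    x = ![k.1, k.2.1, k.2.2] t := by
  unfold tag at ht
  split_ifs at ht with h1 h2 h3 <;> simp only [Option.some.injEq] at ht <;> subst ht <;> assumption

lemma mem_tags {C : Type} {n : ℕ} {cols : Fin n → C} {k : C × C × C} {t : Fin 3} :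
    t ∈ tags cols k ↔ ∃ j, tag k (cols j) = some t := by
  simp [tags]

lemma tags_nodup {C : Type} {n : ℕ} {cols : Fin n → C} (hc : Function.Injective cols)
    (k : C × C × C) : (tags cols k).Nodup := by
  refine (List.nodup_finRange n).filterMap fun i j t hi hj => hc ?_
  rw [eq_of_tag_eq hi, eq_of_tag_eq hj]

lemma Adm.fsum_tags (h : Adm p q) {a b : ℝ} (hab : ∀ t, code a b t ∈ Fset p q) {C : Type} {n : ℕ}
    (cols : Fin n → C) (k : C × C × C) :
    fsum p q (fun j => .fin (code a b (tag k (cols j)))) = codeSum p q a b (tags cols k) := by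
  unfold fsum codeSum tags
  rw [h.fsuml_eq_foldl (by simpa [EF.Valid] using fun j => hab _)]
  have h0 := h.zero_valid
  generalize EF.fin 0 = z at h0
  induction List.finRange n generalizing z with
  | nil => rfl
  | cons j l ih =>
    rw [List.map_cons, List.foldl_cons, ih _ (h.fadd_valid _ _)]
    cases ht : tag k (cols j) with
    | none => rw [List.filterMap_cons_none (f := fun j => tag k (cols j)) ht, code, h.fadd_zero h0]
    | some t =>
      rw [List.filterMap_cons_some (f := fun j => tag k (cols j)) ht, List.map_cons,
        List.foldl_cons]

lemma Absorbs.code_mem {a b : ℝ} (h : Adm p q) (hab : Absorbs p q a b) (t : Option (Fin 3)) :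
    code a b t ∈ Fset p q := by
  rcases t with _ | t
  · exact h.zero_mem
  · fin_cases t
    exacts [hab.mem_left, neg_mem_Fset hab.mem_left, hab.mem_right]

lemma Adm.codeSum_tags_diag (h : Adm p q) {a b : ℝ} (hab : Absorbs p q a b) {C : Type} {n : ℕ}
    {cols : Fin n → C} (hc : Function.Injective cols) (c : C) :
    codeSum p q a b (tags cols (c, c, c)) = .fin b ↔ ∃ j, cols j = c := by
  have ht : ∀ x t, tag (c, c, c) x = some t ↔ x = c ∧ t = 2 := by
    intro x t
    unfold tag
    by_cases hx : x = c <;> simp [hx, eq_comm]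
  rw [(h.codeSum_spec hab (tags_nodup hc _)).2.1, mem_tags]
  · simp [ht]
  · intro t
    rw [mem_tags]
    rintro ⟨j, hj⟩
    exact ((ht _ _).mp hj).2

lemma Adm.codeSum_tags_lt (h : Adm p q) {a b : ℝ} (hab : Absorbs p q a b) {C : Type} {n : ℕ}
    {cols : Fin n → C} (hc : Function.Injective cols) {i j k : Fin n} (hij : i ≠ j) (hik : i ≠ k)
    (hjk : j ≠ k) :
    codeSum p q a b (tags cols (cols i, cols j, cols k)) = .fin b ↔ i < k ∧ j < k := by
  refine (h.codeSum_spec hab (tags_nodup hc _)).2.2 ![i, j, k] ?_ ?_ ?_ ?_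
  · exact mem_tags.mpr ⟨i, by simp [tag, hc.eq_iff, hik]⟩
  · exact mem_tags.mpr ⟨j, by simp [tag, hc.eq_iff, hjk, hij.symm]⟩
  · exact mem_tags.mpr ⟨k, by simp [tag]⟩
  · unfold tags
    rw [List.pairwise_filterMap]
    have hpos : ∀ x t, tag (cols i, cols j, cols k) (cols x) = some t → ![i, j, k] t = x := by
      intro x t ht
      have := eq_of_tag_eq ht
      apply hc
      rw [this]
      fin_cases t <;> rfl
    refine (List.pairwise_lt_finRange n).imp fun hxy s hs t ht => ?_
    rw [hpos _ _ hs, hpos _ _ ht]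
    exact hxy

/-- The features determine an injective sequence of columns up to exchanging the first two. -/
lemma Adm.eq_or_eq_swap (h : Adm p q) {a b : ℝ} (hab : Absorbs p q a b) {C : Type} {n : ℕ}
    (hn : 2 ≤ n) {cols cols' : Fin n → C} (hc : Function.Injective cols)
    (hc' : Function.Injective cols')
    (heq : ∀ k, codeSum p q a b (tags cols k) = codeSum p q a b (tags cols' k)) :
    cols' = cols ∨ cols' = cols ∘ swap12 n hn := by
  have hex : ∀ i, ∃ j, cols' j = cols i := fun i => by
    rw [← h.codeSum_tags_diag hab hc', ← heq, h.codeSum_tags_diag hab hc]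
    exact ⟨i, rfl⟩
  choose ρ hρ using hex
  have hinj : Function.Injective ρ := fun i j hij => hc (by rw [← hρ, ← hρ, hij])
  have hlt : ∀ i k : Fin n, i < k → 2 ≤ (k : ℕ) → ρ i < ρ k := by
    intro i k hik hk
    obtain ⟨j, hji, hjk⟩ : ∃ j : Fin n, j ≠ i ∧ j < k := by
      by_cases hi : (i : ℕ) = 0
      · exact ⟨⟨1, by omega⟩, fun hc => by simp [← hc] at hi, Fin.mk_lt_of_lt_val (by omega)⟩
      · exact ⟨⟨0, by omega⟩, fun hc => by simp [← hc] at hi, Fin.mk_lt_of_lt_val (by omega)⟩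
    have h1 := (h.codeSum_tags_lt hab hc hji.symm hik.ne hjk.ne).mpr ⟨hik, hjk⟩
    rw [heq, ← hρ i, ← hρ j, ← hρ k, h.codeSum_tags_lt hab hc' (hinj.ne hji.symm) (hinj.ne hik.ne)
      (hinj.ne hjk.ne)] at h1
    exact h1.1
  rcases lt_or_gt_of_ne (hinj.ne (show (⟨0, by omega⟩ : Fin n) ≠ ⟨1, by omega⟩ by simp))
    with h01 | h01
  · left
    have := StrictMono.eq_id (f := ρ) fun i k hik => ?_
    · funext i
      rw [← hρ i, this, id]
    · by_cases hk : 2 ≤ (k : ℕ)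
      · exact hlt i k hik hk
      · have hik' := Fin.lt_def.mp hik
        rw [show i = ⟨0, by omega⟩ from Fin.ext (by simp; omega),
          show k = ⟨1, by omega⟩ from Fin.ext (by simp; omega)]
        exact h01
  · right
    have hs0 : swap12 n hn ⟨0, by omega⟩ = ⟨1, by omega⟩ := Equiv.swap_apply_left _ _
    have hs1 : swap12 n hn ⟨1, by omega⟩ = ⟨0, by omega⟩ := Equiv.swap_apply_right _ _
    have hs2 : ∀ k : Fin n, 2 ≤ (k : ℕ) → swap12 n hn k = k := fun k hk =>
      Equiv.swap_apply_of_ne_of_ne (fun hc => by simp [hc] at hk) (fun hc => by simp [hc] at hk)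
    have := StrictMono.eq_id (f := ρ ∘ swap12 n hn) fun i k hik => ?_
    · funext i
      have h1 := hρ (swap12 n hn i)
      rw [show ρ (swap12 n hn i) = i from congrFun this i] at h1
      exact h1
    · have hik' := Fin.lt_def.mp hik
      by_cases hk : 2 ≤ (k : ℕ)
      · rw [Function.comp, Function.comp, hs2 k hk]
        refine hlt _ _ ?_ hk
        by_cases hi : 2 ≤ (i : ℕ)
        · rwa [hs2 i hi]
        · by_cases hi0 : (i : ℕ) = 0
          · rw [show i = ⟨0, by omega⟩ from Fin.ext hi0, hs0]
            exact Fin.mk_lt_of_lt_val (by omega)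
          · rw [show i = ⟨1, by omega⟩ from Fin.ext (by simp; omega), hs1]
            exact Fin.mk_lt_of_lt_val (by omega)
      · rw [show i = ⟨0, by omega⟩ from Fin.ext (by simp; omega),
          show k = ⟨1, by omega⟩ from Fin.ext (by simp; omega), Function.comp, Function.comp,
          hs0, hs1]
        exact h01

/-! ### Attention with uniform weights -/

/-- An attention block that averages the registers `eV` over all columns, without a
feed-forward part. -/
noncomputable def avgBlock (r : ℕ) {m d : ℕ} {M : Type} (e : M ≃ Fin m) (eV eF : M → Fin d) :
    Block 1 m r d where
  WK := fun _ _ _ => 0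
  WQ := fun _ _ _ => 0
  WV := fun _ a => Pi.single (eV (e.symm a)) 1
  WO := fun _ i a => if eF (e.symm a) = i then 1 else 0
  W1 := fun _ _ => 0
  W2 := fun _ _ => 0
  b1 := fun _ => 0
  b2 := fun _ => 0

lemma Adm.avgBlock_valid (h : Adm p q) (r : ℕ) {m d : ℕ} {M : Type} (e : M ≃ Fin m)
    (eV eF : M → Fin d) : (avgBlock r e eV eF).Valid p q := by
  have h0 := h.zero_mem
  refine ⟨fun _ _ _ => h0, fun _ _ _ => h0, fun _ _ _ => single_mem h0 h.one_mem _ _,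
    fun _ i a => ?_, fun _ _ => h0, fun _ _ => h0, fun _ => h0, fun _ => h0⟩
  show (if _ then _ else _) ∈ _
  split_ifs
  exacts [h.one_mem, h0]

lemma Adm.ffApply_zero (h : Adm p q) {m r d n : ℕ} (B : Block 1 m r d) (h1 : B.W1 = fun _ _ => 0)
    (h2 : B.W2 = fun _ _ => 0) (h3 : B.b1 = fun _ => 0) (h4 : B.b2 = fun _ => 0)
    {X : Fin d → Fin n → ℝ} (hX : RealMatFin p q X) : ffApply p q B (toEF X) = toEF X := by
  have hz : ∀ {a b : ℕ} (i : Fin a) (j : Fin b), frelu p q (madd p q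
      (toEF fun (_ : Fin a) (_ : Fin b) => (0 : ℝ)) (fun _ _ => .fin 0) i j) = .fin 0 := by
    intro a b i j
    show frelu p q (fadd p q (.fin 0) (.fin 0)) = _
    rw [h.fadd_zero h.zero_valid, h.frelu_fin h.zero_mem, max_self]
  unfold ffApply
  simp only [h1, h2, h3, h4, h.mmul_zero_left, hz]
  rw [show (fun (_ : Fin r) (_ : Fin n) => EF.fin 0) = toEF fun _ _ => 0 from rfl,
    h.mmul_zero_left]
  funext i j
  show fadd p q (.fin (X i j)) (fadd p q (.fin 0) (.fin 0)) = _
  rw [h.fadd_zero h.zero_valid, h.fadd_zero (valid_fin (hX i j))]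
  rfl

lemma Adm.avgBlock_apply (h : Adm p q) (r : ℕ) {m d n : ℕ} (hn : 0 < n) {M : Type}
    (e : M ≃ Fin m) {eV eF : M → Fin d} (hF : Function.Injective eF) {X : Fin d → Fin n → ℝ}
    (hX : RealMatFin p q X) {f : M → ℝ} (hf : ∀ k, f k ∈ Fset p q)
    (hsum : ∀ k, fsum p q (fun j => fmul p q (.fin (X (eV k) j)) (.fin (unifWeight p q n)))
      = .fin (f k)) (h0 : ∀ k j, X (eF k) j = 0) :
    (avgBlock r e eV eF).apply p q (toEF X) = toEF (upd eF (fun k _ => f k) X) := by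
  have hfin : RealMatFin p q (upd eF (fun k (_ : Fin n) => f k) X) :=
    upd_fin hF (fun k _ => hf k) hX
  unfold Block.apply
  rw [h.attnApply_eq hn _ rfl rfl]
  have hV : mmul p q (toEF ((avgBlock r e eV eF).WV 0)) (toEF X)
      = toEF fun a j => X (eV (e.symm a)) j := by
    funext a j
    refine (h.fsum_single_weight (w := 1) (eV (e.symm a)) (fun i => X i j)).trans ?_
    exact h.one_fmul (hX _ _)
  have hS : mmul p q (toEF fun a j => X (eV (e.symm a)) j)
      (toEF fun (_ : Fin n) (_ : Fin n) => unifWeight p q n)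
      = toEF fun a _ => f (e.symm a) := by
    funext a j
    exact hsum (e.symm a)
  have hO : madd p q (toEF X) (mmul p q (toEF ((avgBlock r e eV eF).WO 0))
      (toEF fun a _ => f (e.symm a))) = toEF (upd eF (fun k _ => f k) X) := by
    funext i j
    by_cases hi : ∃ k, eF k = i
    · obtain ⟨k, rfl⟩ := hi
      have hm : mmul p q (toEF ((avgBlock r e eV eF).WO 0)) (toEF fun a (_ : Fin n) => f (e.symm a))
          (eF k) j = .fin (f k) := by
        have hk : fmul p q (.fin (if eF (e.symm (e k)) = eF k then 1 else 0))
            (.fin (f (e.symm (e k)))) = .fin (f k) := by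
          rw [e.symm_apply_apply, if_pos rfl]
          exact h.one_fmul (hf k)
        refine (h.fsum_single (e k) (fun a ha => ?_) ?_).trans hk
        · show fmul p q (.fin (if eF (e.symm a) = eF k then 1 else 0)) _ = _
          rw [if_neg]
          · exact h.zero_fmul _
          · exact fun hc => ha (by rw [← hF hc, e.apply_symm_apply])
        · exact h.rnd_valid _
      show fadd p q (.fin (X (eF k) j)) _ = .fin _
      rw [hm, h0, upd_apply hF, h.zero_fadd (valid_fin (hf k))]
    · have hi' : ∀ k, eF k ≠ i := by push Not at hi; exact hi
      have hm : mmul p q (toEF ((avgBlock r e eV eF).WO 0)) (toEF fun a (_ : Fin n) => f (e.symm a))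
          i j = .fin 0 := by
        refine h.fsum_zero fun a => ?_
        show fmul p q (.fin (if eF (e.symm a) = i then 1 else 0)) _ = _
        rw [if_neg (hi' _)]
        exact h.zero_fmul _
      show fadd p q (.fin (X i j)) _ = .fin _
      rw [hm, upd_apply' _ _ hi', h.fadd_zero (valid_fin (hX i j))]
  rw [hV, hS, hO]
  exact h.ffApply_zero _ rfl rfl rfl rfl hfin

lemma Adm.exists_decoder (h : Adm p q) {a b : ℝ} (hab : Absorbs p q a b) {C Y : Type} [Nonempty Y]
    {n : ℕ} (hn : 2 ≤ n) (g : (Fin n → C) → Fin n → Y)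
    (hg : ∀ cols, Function.Injective cols → ∀ j,
      g (cols ∘ swap12 n hn) j = g cols (swap12 n hn j)) :
    ∃ G : C → (C × C × C → EF) → Y, ∀ cols, Function.Injective cols → ∀ j,
      G (cols j) (fun k => codeSum p q a b (tags cols k)) = g cols j := by
  have key : ∀ (x : C) (φ : C × C × C → EF), ∃ y, ∀ cols, Function.Injective cols → ∀ j,
      cols j = x → (fun k => codeSum p q a b (tags cols k)) = φ → g cols j = y := by
    intro x φ
    by_cases hex : ∃ cols : Fin n → C, Function.Injective cols ∧ ∃ j, cols j = x ∧
        (fun k => codeSum p q a b (tags cols k)) = φ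
    · obtain ⟨cols, hc, j, hj, hφ⟩ := hex
      refine ⟨g cols j, fun cols' hc' j' hj' hφ' => ?_⟩
      rcases h.eq_or_eq_swap hab hn hc hc' (congrFun (hφ.trans hφ'.symm)) with rfl | rfl
      · rw [hc (hj'.trans hj.symm)]
      · rw [hg _ hc, hc (hj'.trans hj.symm)]
    · obtain ⟨y⟩ := ‹Nonempty Y›
      exact ⟨y, fun cols hc j hj hφ => (hex ⟨cols, hc, j, hj, hφ⟩).elim⟩
  choose G hG using key
  exact ⟨G, fun cols hc j => (hG _ _ cols hc j rfl rfl).symm ▸ rfl⟩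

lemma Adm.exists_blocks (h : Adm p q) {din dout n : ℕ} (hn : 2 ≤ n)
    (g : (Fin n → Fin din → Fset p q) → Fin n → Fin dout → Fset p q)
    (hg : ∀ cols, Function.Injective cols → ∀ j,
      g (cols ∘ swap12 n hn) j = g cols (swap12 n hn j)) :
    ∃ (m r d : ℕ) (L : List (Block 1 m r d)) (inp : Fin din → Fin d) (out : Fin dout → Fin d),
      0 < m ∧ 0 < r ∧ 0 < d ∧ L ≠ [] ∧ (∀ B ∈ L, B.Valid p q) ∧ Function.Injective inp ∧
      ∀ cols : Fin n → Fin din → Fset p q, Function.Injective cols →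
        ∃ X : Fin d → Fin n → ℝ, RealMatFin p q X ∧
        blocksApply p q L (toEF (upd inp (fun a j => (cols j a : ℝ)) fun _ _ => 0)) = toEF X ∧
        ∀ o j, X (out o) j = g cols j o := by
  have hn0 : 0 < n := by omega
  have : Nonempty (Fset p q) := ⟨⟨0, h.zero_mem⟩⟩
  obtain ⟨hs, hs1, hs2, -⟩ := h.unifWeight_spec hn0
  obtain ⟨α, β, a, b, hαβ, hab, hmul⟩ := h.exists_code hs hs1 hs2
  obtain ⟨G, hG⟩ := h.exists_decoder hab hn g hg
  let C := Fin din → Fset p q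
  let M := C × C × C
  let I := ((Fin din ⊕ M) ⊕ (M ⊕ Fin dout)) ⊕
    ((Fin 3 × Fin din × Fset p q) ⊕ (Fin 3 × (Fin din ⊕ M) × Fset p q))
  obtain ⟨d, ⟨E⟩⟩ := Finite.exists_equiv_fin I
  let inp : Fin din → Fin d := fun i => E (.inl (.inl (.inl i)))
  let val : M → Fin d := fun k => E (.inl (.inl (.inr k)))
  let feat : M → Fin d := fun k => E (.inl (.inr (.inl k)))
  let out : Fin dout → Fin d := fun o => E (.inl (.inr (.inr o)))
  let H := ((Fin din × Fset p q × Bool) ⊕ C) ⊕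
    (((Fin din ⊕ M) × Fset p q × Bool) ⊕ ((Fin din ⊕ M) → Fset p q))
  obtain ⟨r, ⟨EH⟩⟩ := Finite.exists_equiv_fin H
  obtain ⟨m, ⟨EM⟩⟩ := Finite.exists_equiv_fin M
  let reg₁ : (Fin din ⊕ M) ⊕ (Fin 3 × Fin din × Fset p q) → Fin d :=
    fun s => E (s.map .inl .inl)
  let reg₂ : ((Fin din ⊕ M) ⊕ Fin dout) ⊕ (Fin 3 × (Fin din ⊕ M) × Fset p q) →
      Fin d :=
    fun s => E (s.map (Sum.elim (Sum.map .inl .inl) (.inr ∘ .inr)) .inr)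
  have hreg₁ : Function.Injective reg₁ := E.injective.comp
    (Sum.map_injective.mpr ⟨Sum.inl_injective, Sum.inl_injective⟩)
  have hreg₂ : Function.Injective reg₂ := by
    refine E.injective.comp (Sum.map_injective.mpr ⟨?_, Sum.inr_injective⟩)
    rintro ((x | x) | x) ((y | y) | y) hxy <;> simp_all
  obtain ⟨L₁, -, hval₁, happ₁⟩ := h.exists_memory m hreg₁
    (eU := fun x => EH (.inl (.inl x)))
    (EH.injective.comp (Sum.inl_injective.comp Sum.inl_injective))
    (eC := fun x => EH (.inl (.inr x)))
    (EH.injective.comp (Sum.inl_injective.comp Sum.inr_injective))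
    (fun x k => ⟨code α β (tag k x), hαβ _⟩)
  obtain ⟨L₂, -, hval₂, happ₂⟩ := h.exists_memory m hreg₂
    (eU := fun x => EH (.inr (.inl x)))
    (EH.injective.comp (Sum.inr_injective.comp Sum.inl_injective))
    (eC := fun x => EH (.inr (.inr x)))
    (EH.injective.comp (Sum.inr_injective.comp Sum.inr_injective))
    (fun y => G (fun i => y (.inl i)) fun k => .fin (y (.inr k)))
  have hfeat : Function.Injective feat := E.injective.comp
    (Sum.inl_injective.comp (Sum.inr_injective.comp Sum.inl_injective))
  have hinp : Function.Injective inp := E.injective.comp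
    (Sum.inl_injective.comp (Sum.inl_injective.comp Sum.inl_injective))
  have hE : ∀ {x y}, x ≠ y → E x ≠ E y := fun hxy hc => hxy (E.injective hc)
  let B : Block 1 m r d :=
    avgBlock _ EM val feat
  have x₀ : M := Classical.arbitrary M
  refine ⟨m, r, d, L₁ ++ ([B] ++ L₂), inp, out, (EM x₀).pos, (EH (.inl (.inr x₀.1))).pos,
    (val x₀).pos, by simp, ?_, hinp, fun cols hc => ?_⟩
  · simp only [List.mem_append, List.mem_singleton]
    rintro B' (hB | rfl | hB)
    exacts [hval₁ _ hB, h.avgBlock_valid _ _ _ _, hval₂ _ hB]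
  have hz : RealMatFin p q fun (_ : Fin d) (_ : Fin n) => 0 :=
    fun _ _ => h.zero_mem
  have hX0 : RealMatFin p q (upd inp (fun a j => (cols j a : ℝ)) fun _ _ => 0) :=
    upd_fin hinp (fun a j => (cols j a).2) hz
  have hX0z : ∀ {x} j, (∀ i, (.inl (.inl (.inl i)) : I) ≠ x) →
      upd inp (fun a j => (cols j a : ℝ)) (fun _ _ => 0) (E x) j = 0 := fun j hx => by
    rw [upd_apply' _ _ fun i => hE (hx i)]
  obtain ⟨X₁, hX₁, hX₁e, hX₁k, hX₁v⟩ := happ₁ n hn0 _ hX0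
    (fun o j => hX0z j nofun) (fun s j => hX0z j nofun)
  choose f hf hfe using fun k => (h.codeSum_spec hab (tags_nodup hc k)).1
  have hX₁z : ∀ {x : (M ⊕ Fin dout) ⊕ (Fin 3 × (Fin din ⊕ M) × Fset p q)} j,
      X₁ (E (x.map .inr .inr)) j = 0 := by
    intro x j
    rw [hX₁k _ (fun o => hE (by rcases x with (x | x) | x <;> nofun))
      (fun s => hE (by rcases x with (x | x) | x <;> nofun))]
    exact hX0z j (by rcases x with (x | x) | x <;> nofun)
  have hX₁in : ∀ i j, X₁ (inp i) j = cols j i := fun i j =>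
    (congrFun (hX₁k (inp i) (fun o => hE nofun) (fun s => hE nofun)) j).trans
      (congrFun (upd_apply hinp _ _ i) j)
  have hav := h.avgBlock_apply r hn0 EM (eV := val) hfeat hX₁ hf
    (fun k => by
      rw [← hfe, ← h.fsum_tags (hab.code_mem h) cols k]
      congr 1
      funext j
      rw [← hmul]
      congr 2
      refine (hX₁v k j).trans ?_
      exact congrArg (fun x => code α β (tag k x))
        (funext fun i => Subtype.ext
          (congrFun (upd_apply hinp (fun a j => (cols j a : ℝ)) (fun _ _ => 0) i) j)))
    (fun k j => hX₁z (x := .inl (.inl k)) j)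
  have hX₂ : RealMatFin p q (upd feat (fun k _ => f k) X₁) := upd_fin hfeat (fun k _ => hf k) hX₁
  have hX₂z : ∀ {x : Fin dout ⊕ (Fin 3 × (Fin din ⊕ M) × Fset p q)} j,
      upd feat (fun k _ => f k) X₁ (E (x.map (.inr ∘ .inr) .inr)) j = 0 := by
    intro x j
    rw [upd_apply' _ _ (fun k => hE (by cases x <;> nofun))]
    exact (by cases x <;> rfl : X₁ (E (x.map (.inr ∘ .inr) .inr)) j
      = X₁ (E ((x.map .inr id).map .inr .inr)) j).trans (hX₁z j)
  obtain ⟨X₃, hX₃, hX₃e, -, hX₃v⟩ := happ₂ n hn0 _ hX₂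
    (fun o j => hX₂z (x := .inl o) j) (fun s j => hX₂z (x := .inr s) j)
  refine ⟨X₃, hX₃, ?_, fun o j => (hX₃v o j).trans ?_⟩
  · rw [blocksApply_append, hX₁e, blocksApply_append]
    exact (congrArg _ hav).trans hX₃e
  · rw [← hG cols hc j]
    have h1 : ∀ i, upd feat (fun k _ => f k) X₁ (inp i) j = cols j i := fun i =>
      (congrFun (upd_apply' (eT := feat) (i := inp i) _ _ fun k => hE nofun) j).trans (hX₁in i j)
    have h2 : ∀ k, upd feat (fun k _ => f k) X₁ (feat k) j = f k := fun k =>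
      congrFun (upd_apply hfeat _ _ k) j
    congr 3
    · funext i
      exact Subtype.ext (h1 i)
    · funext k
      rw [hfe]
      exact congrArg _ (h2 k)

end FPT

/-- Floating-point transformers can represent every
`π_{(1,2)}^n`-equivariant function on the set `Δ_n` of inputs with distinct columns. -/
theorem stmt0 (p q : ℕ) (hp : 2 ≤ p) (hpq : (p : ℤ) ≤ 2 ^ (q - 1) - 3)
    (din dout n : ℕ) (hdin : 0 < din) (hdout : 0 < dout) (hn : 2 ≤ n)
    (fstar : FPT.Mat din n → FPT.Mat dout n)
    (hfin : ∀ X : FPT.Mat din n, FPT.MatFin p q X → FPT.DistinctCols X →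
      FPT.MatFin p q (fstar X))
    (hequiv : ∀ X : FPT.Mat din n, FPT.MatFin p q X → FPT.DistinctCols X →
      fstar (FPT.permCols (FPT.swap12 n hn) X) = FPT.permCols (FPT.swap12 n hn) (fstar X)) :
    ∃ f : FPT.Mat din n → FPT.Mat dout n,
      FPT.IsTransformer p q din dout n f ∧
        ∀ X : FPT.Mat din n, FPT.MatFin p q X → FPT.DistinctCols X → f X = fstar X := by
  open FPT in
  have h : Adm p q := ⟨hp, hpq⟩
  have hreal : ∀ {a b : ℕ} {X : Mat a b}, MatFin p q X →
      ∃ c : Fin b → Fin a → Fset p q, X = fun i j => .fin (c j i) := by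
    intro a b X hX
    have hx : ∀ j i, ∃ x : Fset p q, X i j = .fin x := fun j i => by
      have := hX i j
      cases hv : X i j with
      | fin x => exact ⟨⟨x, by rwa [hv] at this⟩, rfl⟩
      | _ => rw [hv] at this; exact this.elim
    choose c hc using hx
    exact ⟨c, funext₂ fun i j => hc j i⟩
  let ofCols : (Fin n → Fin din → Fset p q) → Mat din n := fun cols i j => .fin (cols j i)
  have hcolsF : ∀ cols, MatFin p q (ofCols cols) := fun cols i j => (cols j i).2
  have hcolsD : ∀ cols, DistinctCols (ofCols cols) ↔ Function.Injective cols := by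
    intro cols
    constructor
    · intro hd j k hjk
      by_contra hne
      obtain ⟨i, hi⟩ := hd j k hne
      exact hi (by simp only [ofCols, hjk])
    · intro hi j k hjk
      by_contra! hc
      exact hjk (hi (funext fun i => Subtype.ext (EF.fin.inj (hc i))))
  have hg : ∀ cols, ∃ y : Fin n → Fin dout → Fset p q, Function.Injective cols →
      fstar (ofCols cols) = fun o j => .fin (y j o) := by
    intro cols
    by_cases hc : Function.Injective cols
    · obtain ⟨y, hy⟩ := hreal (hfin _ (hcolsF cols) ((hcolsD cols).mpr hc))
      exact ⟨y, fun _ => hy⟩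
    · exact ⟨fun _ _ => ⟨0, h.zero_mem⟩, fun hc' => (hc hc').elim⟩
  choose g hg using hg
  obtain ⟨m, r, d, L, inp, out, hm, hr, hd, hL, hval, hinp, hX⟩ := h.exists_blocks hn g (by
    intro cols hc j
    have h1 := hequiv _ (hcolsF cols) ((hcolsD cols).mpr hc)
    rw [show permCols (swap12 n hn) (ofCols cols) = ofCols (cols ∘ swap12 n hn) from rfl,
      hg _ (hc.comp (swap12 n hn).injective), hg _ hc] at h1
    exact funext fun o => Subtype.ext (EF.fin.inj (congrFun (congrFun h1 o) j)))
  have h0 := h.zero_mem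
  let Win : Fin d → Fin din → ℝ := fun i a => if inp a = i then 1 else 0
  let Wout : Fin dout → Fin d → ℝ := fun o => Pi.single (out o) 1
  refine ⟨_, ⟨1, m, r, d, L, Win, fun _ => 0, Wout, fun _ => 0, one_pos, hm, hr, hd, hL, hval,
    fun i a => ?_, fun _ => h0, fun o i => single_mem h0 h.one_mem _ _, fun _ => h0,
    fun X => rfl⟩, fun X hXF hXD => ?_⟩
  · show (if _ then _ else _) ∈ _
    split_ifs
    exacts [h.one_mem, h0]
  obtain ⟨cols, rfl⟩ := hreal hXF
  have hc := (hcolsD cols).mp hXD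
  obtain ⟨Y, hYF, hY, hYo⟩ := hX cols hc
  have hin : madd p q (mmul p q (toEF Win) (ofCols cols)) (fun _ _ => .fin 0)
      = toEF (upd inp (fun a j => (cols j a : ℝ)) fun _ _ => 0) := by
    funext i j
    show fadd p q (fsum p q _) (.fin 0) = .fin _
    by_cases hi : ∃ a, inp a = i
    · obtain ⟨a, rfl⟩ := hi
      have ha : fmul p q (.fin (Win (inp a) a)) (ofCols cols a j) = .fin (cols j a) := by
        rw [show Win (inp a) a = 1 from if_pos rfl]
        exact h.one_fmul (cols j a).2
      rw [h.fsum_single a (fun b hb => ?_) (h.rnd_valid _)]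
      · rw [upd_apply hinp]
        exact (congrArg (fadd p q · _) ha).trans (h.fadd_zero (valid_fin (cols j a).2))
      · show fmul p q (.fin (if inp b = inp a then 1 else 0)) _ = _
        rw [if_neg (hinp.ne hb)]
        exact h.zero_fmul _
    · have hi' : ∀ a, inp a ≠ i := by push Not at hi; exact hi
      rw [upd_apply' _ _ hi', h.fsum_zero, h.fadd_zero h.zero_valid]
      intro a
      show fmul p q (.fin (if inp a = i then 1 else 0)) _ = _
      rw [if_neg (hi' a)]
      exact h.zero_fmul _
  show madd p q (mmul p q (toEF Wout) (blocksApply p q L (madd p q (mmul p q (toEF Win)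
    (ofCols cols)) fun _ _ => .fin 0))) (fun _ _ => .fin 0) = fstar (ofCols cols)
  rw [hin, hY, hg cols hc]
  funext o j
  show fadd p q (fsum p q fun i => fmul p q (.fin ((Pi.single (out o) 1 : Fin d → ℝ) i))
    (.fin (Y i j))) (.fin 0) = .fin _
  rw [h.fsum_single_weight, h.one_fmul (hYF _ _), h.fadd_zero (valid_fin (hYF _ _)), hYo]
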